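/- Suppose c satisfies (A0), (A1), (A2), Λ is c-convex with respect to Ω, and Ω is c*-convex with respect to Λ. If c satisfies (A3W), then for every x_m ∈ Ω and all y₀, y₁ ∈ Λ, Monotonicity holds for the associated sliding mountains: S⁺_{θ₁} ⊆ S⁺_{θ₂} whenever 0 ≤ θ₁ ≤ θ₂ ≤ 1. -/

import Mathlib

open scoped RealInnerProductSpace
open Filter Topology Set

noncomputable section

variable {n : ℕ}

local notation "E" => EuclideanSpace ℝ (Fin n)

/-- `-∇ₓ c(x,y)`, the negative gradient of `x' ↦ c(x',y)` at `x`. -/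
def negGradX (c : E → E → ℝ) (x y : E) : E :=
  -(gradient (fun x' => c x' y) x)

/-- `-∇_y c(x,y)`, the negative gradient of `y' ↦ c(x,y')` at `y`. -/
def negGradY (c : E → E → ℝ) (x y : E) : E :=
  -(gradient (fun y' => c x y') y)

/-- The swapped cost `c*(y,x) = c(x,y)`. -/
def cStar (c : E → E → ℝ) : E → E → ℝ := fun y x => c x y

/-- The domain of the `c`-exponential map at `x`: `{-∇ₓ c(x,y) : y ∈ Λ}`. -/
def cExpDom (c : E → E → ℝ) (Λ : Set E) (x : E) : Set E :=
  (fun y => negGradX c x y) '' Λ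

/-- The `c`-exponential map: `cExp c Λ x p` is the point `y ∈ Λ` with `p = -∇ₓ c(x,y)`
(when it exists and is unique). -/
def cExp (c : E → E → ℝ) (Λ : Set E) (x p : E) : E :=
  Function.invFunOn (fun y => negGradX c x y) Λ p

/-- Condition (A0): the cost extends to a `C⁴` function on `cl Ω × cl Λ`. -/
def A0 (c : E → E → ℝ) (Ω Λ : Set E) : Prop :=
  ContDiffOn ℝ 4 (fun q : E × E => c q.1 q.2) (closure Ω ×ˢ closure Λ)

/-- Condition (A1): injectivity of `y ↦ -∇ₓ c(x,y)` on `cl Λ` and of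
`x ↦ -∇_y c(x,y)` on `cl Ω`. -/
def A1 (c : E → E → ℝ) (Ω Λ : Set E) : Prop :=
  (∀ x ∈ Ω, Set.InjOn (fun y => negGradX c x y) (closure Λ)) ∧
  (∀ y ∈ Λ, Set.InjOn (fun x => negGradY c x y) (closure Ω))

/-- Condition (A2): the mixed second derivative `D²ₓᵧ c(x,y)`, as a linear map, is
invertible for all `(x,y) ∈ cl Ω × cl Λ`. -/
def A2 (c : E → E → ℝ) (Ω Λ : Set E) : Prop :=
  ∀ x ∈ closure Ω, ∀ y ∈ closure Λ,
    Function.Bijective (fderiv ℝ (fun y' => negGradX c x y') y)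

/-- The `c`-sectional curvature
`𝔖_c(x,y)(η,ξ) = (d²/dt²)|₀ [-D²ₓₓ c](x, cExpₓ(p + tξ))(η,η)` with `p = -∇ₓ c(x,y)`. -/
def cSectional (c : E → E → ℝ) (Λ : Set E) (x y η ξ : E) : ℝ :=
  deriv (deriv (fun t : ℝ =>
    -(iteratedFDeriv ℝ 2
        (fun x' => c x' (cExp c Λ x (negGradX c x y + t • ξ))) x ![η, η]))) 0

/-- Condition (A3W): nonnegative `c`-sectional curvature in orthogonal directions. -/
def A3W (c : E → E → ℝ) (Ω Λ : Set E) : Prop :=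
  ∀ x ∈ Ω, ∀ y ∈ Λ, ∀ η ξ : E, ⟪η, ξ⟫ = 0 → 0 ≤ cSectional c Λ x y η ξ

/-- Condition (A3S): uniformly positive `c`-sectional curvature in orthogonal directions. -/
def A3S (c : E → E → ℝ) (Ω Λ : Set E) : Prop :=
  ∃ C₀ > (0:ℝ), ∀ x ∈ Ω, ∀ y ∈ Λ, ∀ η ξ : E, ⟪η, ξ⟫ = 0 →
    C₀ * ‖η‖ ^ 2 * ‖ξ‖ ^ 2 ≤ cSectional c Λ x y η ξ

/-- `Λ` is `c`-convex with respect to `Ω`: `(cExpₓ)⁻¹(Λ)` is convex for every `x ∈ Ω`. -/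
def CConvexTarget (c : E → E → ℝ) (Ω Λ : Set E) : Prop :=
  ∀ x ∈ Ω, Convex ℝ (cExpDom c Λ x)

/-- `Ω` is `c*`-convex with respect to `Λ`: `(c*Exp_y)⁻¹(Ω)` is convex for every `y ∈ Λ`. -/
def CStarConvexSource (c : E → E → ℝ) (Ω Λ : Set E) : Prop :=
  ∀ y ∈ Λ, Convex ℝ ((fun x => negGradY c x y) '' Ω)

/-- The `c`-Legendre transform `L^c v(x) = sup_{y ∈ Λ} (-c(x,y) - v(y))`. -/
def cTransform (c : E → E → ℝ) (Λ : Set E) (v : E → EReal) (x : E) : EReal :=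
  ⨆ y ∈ Λ, (((-(c x y) : ℝ) : EReal) - v y)

/-- `φ` is a `c`-convex function on `Ω` indexed by `Λ`. -/
def IsCConvexOn (c : E → E → ℝ) (Ω Λ : Set E) (φ : E → ℝ) : Prop :=
  ∃ v : E → EReal,
    (∀ x ∈ Ω, (φ x : EReal) = cTransform c Λ v x) ∧
    (∀ x ∈ Ω, ∃ y ∈ closure Λ, (φ x : EReal) + v y = ((-(c x y) : ℝ) : EReal))

/-- The `c*`-Legendre transform `L^{c*} φ(y) = sup_{x ∈ Ω} (-c(x,y) - φ(x))`. -/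
def cStarTransform (c : E → E → ℝ) (Ω : Set E) (φ : E → ℝ) (y : E) : EReal :=
  ⨆ x ∈ Ω, (((-(c x y) - φ x : ℝ)) : EReal)

/-- The contact set `G_φ(x) = {y ∈ cl Λ : φ(x) + L^{c*}φ(y) = -c(x,y)}`. -/
def contactSet (c : E → E → ℝ) (Ω Λ : Set E) (φ : E → ℝ) (x : E) : Set E :=
  {y ∈ closure Λ | (φ x : EReal) + cStarTransform c Ω φ y = ((-(c x y) : ℝ) : EReal)}

/-- The (local) subdifferential `∂φ(x)`:
`φ(z) ≥ φ(x) + ⟨p, z - x⟩ + o(‖z - x‖)` as `z → x` in `Ω`. -/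
def subdiff (Ω : Set E) (φ : E → ℝ) (x : E) : Set E :=
  {p : E | ∀ ε > (0:ℝ), ∀ᶠ z in 𝓝[Ω] x,
      φ x + ⟪p, z - x⟫ - ε * ‖z - x‖ ≤ φ z}

/-- The `c`-subdifferential `∂^c φ(x) = {-∇ₓ c(x,y) : y ∈ G_φ(x)}`. -/
def cSubdiff (c : E → E → ℝ) (Ω Λ : Set E) (φ : E → ℝ) (x : E) : Set E :=
  (fun y => negGradX c x y) '' contactSet c Ω Λ φ x

/-- The straight segment `p_θ = (1-θ) p₀ + θ p₁` with `pᵢ = -∇ₓ c(x_m, yᵢ)`. -/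
def pSeg (c : E → E → ℝ) (xm y₀ y₁ : E) (θ : ℝ) : E :=
  (1 - θ) • negGradX c xm y₀ + θ • negGradX c xm y₁

/-- The `c`-segment `y_θ = cExp_{x_m}(p_θ)` joining `y₀` to `y₁` with respect to `x_m`. -/
def ySeg (c : E → E → ℝ) (Λ : Set E) (xm y₀ y₁ : E) (θ : ℝ) : E :=
  cExp c Λ xm (pSeg c xm y₀ y₁ θ)

/-- The sliding mountain `f_θ(x) = -c(x, y_θ) + c(x_m, y_θ)`. -/
def slide (c : E → E → ℝ) (Λ : Set E) (xm y₀ y₁ : E) (θ : ℝ) (x : E) : ℝ :=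
  -(c x (ySeg c Λ xm y₀ y₁ θ)) + c xm (ySeg c Λ xm y₀ y₁ θ)

/-- The `c`-segment `[y₀,y₁]_{x_m}` lies in `Λ`:
each `p_θ`, `θ ∈ [0,1]`, is in the domain of `cExp_{x_m}`. -/
def segInTarget (c : E → E → ℝ) (Λ : Set E) (xm y₀ y₁ : E) : Prop :=
  ∀ θ ∈ Set.Icc (0:ℝ) 1, pSeg c xm y₀ y₁ θ ∈ cExpDom c Λ xm

/-- The level set `S_θ = {x ∈ Ω : (d/dθ) f_θ(x) = 0}`. -/
def Slevel (c : E → E → ℝ) (Ω Λ : Set E) (xm y₀ y₁ : E) (θ : ℝ) : Set E :=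
  {x ∈ Ω | deriv (fun θ' => slide c Λ xm y₀ y₁ θ' x) θ = 0}

/-- The super-level set `S⁺_θ = {x ∈ Ω : (d/dθ) f_θ(x) ≥ 0}`. -/
def Splus (c : E → E → ℝ) (Ω Λ : Set E) (xm y₀ y₁ : E) (θ : ℝ) : Set E :=
  {x ∈ Ω | 0 ≤ deriv (fun θ' => slide c Λ xm y₀ y₁ θ' x) θ}

section PartialDerivatives

/-- The partial derivative of `G` in its first real variable. -/
def derivFst (G : ℝ × ℝ → ℝ) (z : ℝ × ℝ) : ℝ := deriv (fun s => G (s, z.2)) z.1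

/-- The partial derivative of `G` in its second real variable. -/
def derivSnd (G : ℝ × ℝ → ℝ) (z : ℝ × ℝ) : ℝ := deriv (fun t => G (z.1, t)) z.2

lemma hasDerivAt_prodMk_const (s t : ℝ) :
    HasDerivAt (fun s' : ℝ => (s', t)) ((1, 0) : ℝ × ℝ) s :=
  (hasDerivAt_id s).prodMk (hasDerivAt_const s t)

lemma hasDerivAt_const_prodMk (s t : ℝ) :
    HasDerivAt (fun t' : ℝ => (s, t')) ((0, 1) : ℝ × ℝ) t :=
  (hasDerivAt_const t s).prodMk (hasDerivAt_id t)

lemma hasDerivAt_fst_of_differentiableAt {V : Type*} [NormedAddCommGroup V] [NormedSpace ℝ V]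
    {G : ℝ × ℝ → V} {s t : ℝ} (hG : DifferentiableAt ℝ G (s, t)) :
    HasDerivAt (fun s' => G (s', t)) (fderiv ℝ G (s, t) (1, 0)) s :=
  hG.hasFDerivAt.comp_hasDerivAt s (hasDerivAt_prodMk_const s t)

lemma hasDerivAt_snd_of_differentiableAt {V : Type*} [NormedAddCommGroup V] [NormedSpace ℝ V]
    {G : ℝ × ℝ → V} {s t : ℝ} (hG : DifferentiableAt ℝ G (s, t)) :
    HasDerivAt (fun t' => G (s, t')) (fderiv ℝ G (s, t) (0, 1)) t :=
  hG.hasFDerivAt.comp_hasDerivAt t (hasDerivAt_const_prodMk s t)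

lemma derivFst_eq_fderiv {G : ℝ × ℝ → ℝ} {z : ℝ × ℝ} (hG : DifferentiableAt ℝ G z) :
    derivFst G z = fderiv ℝ G z (1, 0) :=
  (hasDerivAt_fst_of_differentiableAt (s := z.1) (t := z.2) hG).deriv

lemma derivSnd_eq_fderiv {G : ℝ × ℝ → ℝ} {z : ℝ × ℝ} (hG : DifferentiableAt ℝ G z) :
    derivSnd G z = fderiv ℝ G z (0, 1) :=
  (hasDerivAt_snd_of_differentiableAt (s := z.1) (t := z.2) hG).deriv

lemma tendsto_prodMk_left_nhds (z : ℝ × ℝ) : Tendsto (fun s : ℝ => (s, z.2)) (𝓝 z.1) (𝓝 z) :=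
  (hasDerivAt_prodMk_const z.1 z.2).continuousAt

lemma tendsto_prodMk_right_nhds (z : ℝ × ℝ) : Tendsto (fun t : ℝ => (z.1, t)) (𝓝 z.2) (𝓝 z) :=
  (hasDerivAt_const_prodMk z.1 z.2).continuousAt

lemma derivFst_congr_at {G G' : ℝ × ℝ → ℝ} {z : ℝ × ℝ} (h : G =ᶠ[𝓝 z] G') :
    derivFst G z = derivFst G' z :=
  Filter.EventuallyEq.deriv_eq ((tendsto_prodMk_left_nhds z).eventually h)

lemma derivSnd_congr_at {G G' : ℝ × ℝ → ℝ} {z : ℝ × ℝ} (h : G =ᶠ[𝓝 z] G') :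
    derivSnd G z = derivSnd G' z :=
  Filter.EventuallyEq.deriv_eq ((tendsto_prodMk_right_nhds z).eventually h)

lemma derivFst_congr {G G' : ℝ × ℝ → ℝ} {z : ℝ × ℝ} (h : G =ᶠ[𝓝 z] G') :
    derivFst G =ᶠ[𝓝 z] derivFst G' :=
  h.eventuallyEq_nhds.mono fun _ hz => derivFst_congr_at hz

lemma derivSnd_congr {G G' : ℝ × ℝ → ℝ} {z : ℝ × ℝ} (h : G =ᶠ[𝓝 z] G') :
    derivSnd G =ᶠ[𝓝 z] derivSnd G' :=
  h.eventuallyEq_nhds.mono fun _ hz => derivSnd_congr_at hz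

lemma eventually_differentiableAt {V W : Type*} [NormedAddCommGroup V] [NormedSpace ℝ V]
    [NormedAddCommGroup W] [NormedSpace ℝ W] {G : V → W} {z : V} (hG : ContDiffAt ℝ 1 G z) :
    ∀ᶠ z' in 𝓝 z, DifferentiableAt ℝ G z' :=
  (hG.eventually (by simp)).mono fun _ h => h.differentiableAt (by simp)

lemma ContDiffAt.derivFst {G : ℝ × ℝ → ℝ} {z : ℝ × ℝ} {m k : WithTop ℕ∞}
    (hG : ContDiffAt ℝ k G z) (hmk : m + 1 ≤ k) : ContDiffAt ℝ m (derivFst G) z := by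
  have h1 : ContDiffAt ℝ 1 G z := hG.of_le (le_trans (by simp) hmk)
  refine ContDiffAt.congr_of_eventuallyEq
    ((hG.fderiv_right hmk).clm_apply contDiffAt_const) (f := fun z => fderiv ℝ G z (1, 0)) ?_
  exact (eventually_differentiableAt h1).mono fun _ h => derivFst_eq_fderiv h

lemma ContDiffAt.derivSnd {G : ℝ × ℝ → ℝ} {z : ℝ × ℝ} {m k : WithTop ℕ∞}
    (hG : ContDiffAt ℝ k G z) (hmk : m + 1 ≤ k) : ContDiffAt ℝ m (derivSnd G) z := by
  have h1 : ContDiffAt ℝ 1 G z := hG.of_le (le_trans (by simp) hmk)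
  refine ContDiffAt.congr_of_eventuallyEq
    ((hG.fderiv_right hmk).clm_apply contDiffAt_const) (f := fun z => fderiv ℝ G z (0, 1)) ?_
  exact (eventually_differentiableAt h1).mono fun _ h => derivSnd_eq_fderiv h

lemma derivFst_derivSnd_comm_at {G : ℝ × ℝ → ℝ} {z : ℝ × ℝ} (hG : ContDiffAt ℝ 2 G z) :
    derivFst (derivSnd G) z = derivSnd (derivFst G) z := by
  have h1 := eventually_differentiableAt (hG.of_le (by norm_num : (1 : WithTop ℕ∞) ≤ 2))
  have hd : DifferentiableAt ℝ (fderiv ℝ G) z :=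
    (hG.fderiv_right (m := 1) (by norm_num)).differentiableAt (by simp)
  have hS : derivSnd G =ᶠ[𝓝 z] fun z => fderiv ℝ G z (0, 1) :=
    h1.mono fun _ h => derivSnd_eq_fderiv h
  have hF : derivFst G =ᶠ[𝓝 z] fun z => fderiv ℝ G z (1, 0) :=
    h1.mono fun _ h => derivFst_eq_fderiv h
  rw [derivFst_congr_at hS, derivSnd_congr_at hF,
    derivFst_eq_fderiv (hd.clm_apply (differentiableAt_const _)),
    derivSnd_eq_fderiv (hd.clm_apply (differentiableAt_const _)),
    (hd.hasFDerivAt.clm_apply (hasFDerivAt_const _ _)).fderiv,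
    (hd.hasFDerivAt.clm_apply (hasFDerivAt_const _ _)).fderiv]
  simpa using (hG.isSymmSndFDerivAt (by simp)).eq (1, 0) (0, 1)

lemma derivFst_derivSnd_comm {G : ℝ × ℝ → ℝ} {z : ℝ × ℝ} (hG : ContDiffAt ℝ 2 G z) :
    derivFst (derivSnd G) =ᶠ[𝓝 z] derivSnd (derivFst G) :=
  (hG.eventually (by simp)).mono fun _ h => derivFst_derivSnd_comm_at h

lemma derivFst_derivSnd_derivSnd {H : ℝ × ℝ → ℝ} {z : ℝ × ℝ} (hH : ContDiffAt ℝ 3 H z) :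
    derivFst (derivSnd (derivSnd H)) =ᶠ[𝓝 z] derivSnd (derivSnd (derivFst H)) :=
  (derivFst_derivSnd_comm (hH.derivSnd (by norm_num))).trans
    (derivSnd_congr (derivFst_derivSnd_comm (hH.of_le (by norm_num))))

lemma derivFst_derivFst_derivSnd {H : ℝ × ℝ → ℝ} {z : ℝ × ℝ} (hH : ContDiffAt ℝ 3 H z) :
    derivFst (derivFst (derivSnd H)) =ᶠ[𝓝 z] derivSnd (derivFst (derivFst H)) :=
  (derivFst_congr (derivFst_derivSnd_comm (hH.of_le (by norm_num)))).trans
    (derivFst_derivSnd_comm (hH.derivFst (by norm_num)))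

lemma derivFst_derivFst_derivSnd_derivSnd {H : ℝ × ℝ → ℝ} {z : ℝ × ℝ} (hH : ContDiffAt ℝ 3 H z)
    (hM : ContDiffAt ℝ 2 (derivSnd (derivFst H)) z) :
    derivFst (derivFst (derivSnd (derivSnd H))) z
      = derivSnd (derivSnd (derivFst (derivFst H))) z := by
  rw [derivFst_congr_at (derivFst_derivSnd_derivSnd hH), derivFst_derivSnd_comm_at hM]
  exact derivSnd_congr_at (derivFst_derivSnd_comm (hH.derivFst (by norm_num)))

/-- The second derivative of a composition along a curve. -/
lemma deriv_deriv_comp {V : Type*} [NormedAddCommGroup V] [NormedSpace ℝ V] {W : V → ℝ}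
    {γ : ℝ → V} {t : ℝ} (hW : ContDiffAt ℝ 2 W (γ t)) (hγ : ContDiffAt ℝ 2 γ t) :
    deriv (deriv (fun t => W (γ t))) t
      = fderiv ℝ (fderiv ℝ W) (γ t) (deriv γ t) (deriv γ t)
        + fderiv ℝ W (γ t) (deriv (deriv γ) t) := by
  have hev : deriv (fun t => W (γ t)) =ᶠ[𝓝 t] fun t => fderiv ℝ W (γ t) (deriv γ t) := by
    filter_upwards [hγ.continuousAt.eventually (eventually_differentiableAt
        (hW.of_le (by norm_num))), eventually_differentiableAt (hγ.of_le (by norm_num))]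
      with t' h1 h2
    exact (h1.hasFDerivAt.comp_hasDerivAt t' h2.hasDerivAt).deriv
  rw [hev.deriv_eq]
  have hγ1 : HasDerivAt γ (deriv γ t) t := (hγ.differentiableAt (by simp)).hasDerivAt
  have hγ2 : HasDerivAt (deriv γ) (deriv (deriv γ) t) t :=
    ((hγ.derivWithin (m := 1) (by norm_num)).differentiableAt (by simp)).hasDerivAt
  have hW2 : HasFDerivAt (fderiv ℝ W) (fderiv ℝ (fderiv ℝ W) (γ t)) (γ t) :=
    ((hW.fderiv_right (m := 1) (by norm_num)).differentiableAt (by simp)).hasFDerivAt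
  exact ((hW2.comp_hasDerivAt t hγ1).clm_apply hγ2).deriv

end PartialDerivatives
section CrossDifference

variable {V : Type*} [NormedAddCommGroup V] [NormedSpace ℝ V]

lemma deriv_deriv_eq_zero_of_affine {f : ℝ → ℝ} {s : ℝ}
    (hf : ∃ a b : ℝ, ∀ᶠ s' in 𝓝 s, f s' = a + s' * b) : deriv (deriv f) s = 0 := by
  obtain ⟨a, b, h⟩ := hf
  have h' : f =ᶠ[𝓝 s] fun s' => a + s' * b := h
  rw [h'.deriv.deriv_eq]
  have : deriv (fun s' : ℝ => a + s' * b) = fun _ => b := by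
    funext s'
    simp
  rw [this, deriv_const]

lemma contDiffAt_comp_curves {W : Type*} [NormedAddCommGroup W] [NormedSpace ℝ W]
    {F : V × V → W} {x y : ℝ → V} {z : ℝ × ℝ} {k : WithTop ℕ∞}
    (hF : ContDiffAt ℝ k F (x z.1, y z.2)) (hx : ContDiffAt ℝ k x z.1)
    (hy : ContDiffAt ℝ k y z.2) :
    ContDiffAt ℝ k (fun z : ℝ × ℝ => F (x z.1, y z.2)) z :=
  ContDiffAt.comp z (f := fun z : ℝ × ℝ => (x z.1, y z.2)) (g := F) hF
    ((hx.comp z contDiffAt_fst).prodMk (hy.comp z contDiffAt_snd))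

lemma eventually_comp_curves {F : V × V → ℝ} {x y : ℝ → V} {z : ℝ × ℝ} {k m : WithTop ℕ∞}
    (hF : ContDiffAt ℝ k F (x z.1, y z.2)) (hk : k ≠ ↑(⊤ : ℕ∞))
    (hx : ContDiffAt ℝ m x z.1) (hy : ContDiffAt ℝ m y z.2) (hm : m ≠ ↑(⊤ : ℕ∞)) :
    ∀ᶠ z' : ℝ × ℝ in 𝓝 z, ContDiffAt ℝ k F (x z'.1, y z'.2) ∧ ContDiffAt ℝ m x z'.1 ∧
      ContDiffAt ℝ m y z'.2 := by
  have hxc : ContinuousAt (fun z : ℝ × ℝ => (x z.1, y z.2)) z :=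
    (hx.continuousAt.comp continuousAt_fst).prodMk (hy.continuousAt.comp continuousAt_snd)
  filter_upwards [hxc.eventually (hF.eventually hk),
    continuousAt_fst.eventually (hx.eventually hm),
    continuousAt_snd.eventually (hy.eventually hm)] with z' h1 h2 h3 using ⟨h1, h2, h3⟩

lemma derivFst_comp_curves {F : V × V → ℝ} {x y : ℝ → V} {z : ℝ × ℝ}
    (hF : DifferentiableAt ℝ F (x z.1, y z.2)) (hx : DifferentiableAt ℝ x z.1) :
    derivFst (fun z => F (x z.1, y z.2)) z = fderiv ℝ F (x z.1, y z.2) (deriv x z.1, 0) :=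
  (hF.hasFDerivAt.comp_hasDerivAt z.1 (hx.hasDerivAt.prodMk (hasDerivAt_const z.1 (y z.2)))).deriv

lemma derivSnd_comp_curves {F : V × V → ℝ} {x y : ℝ → V} {z : ℝ × ℝ}
    (hF : DifferentiableAt ℝ F (x z.1, y z.2)) (hy : DifferentiableAt ℝ y z.2) :
    derivSnd (fun z => F (x z.1, y z.2)) z = fderiv ℝ F (x z.1, y z.2) (0, deriv y z.2) :=
  (hF.hasFDerivAt.comp_hasDerivAt z.2 ((hasDerivAt_const z.2 (x z.1)).prodMk hy.hasDerivAt)).deriv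

lemma derivFst_comp_curves_eventuallyEq {F : V × V → ℝ} {x y : ℝ → V} {z : ℝ × ℝ}
    (hF : ContDiffAt ℝ 1 F (x z.1, y z.2)) (hx : ContDiffAt ℝ 1 x z.1)
    (hy : ContDiffAt ℝ 1 y z.2) :
    derivFst (fun z => F (x z.1, y z.2)) =ᶠ[𝓝 z]
      fun z => fderiv ℝ F (x z.1, y z.2) (deriv x z.1, 0) := by
  filter_upwards [eventually_comp_curves hF (by simp) hx hy (by simp)] with z' hz
  exact derivFst_comp_curves (hz.1.differentiableAt (by simp)) (hz.2.1.differentiableAt (by simp))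

lemma derivSnd_comp_curves_eventuallyEq {F : V × V → ℝ} {x y : ℝ → V} {z : ℝ × ℝ}
    (hF : ContDiffAt ℝ 1 F (x z.1, y z.2)) (hx : ContDiffAt ℝ 1 x z.1)
    (hy : ContDiffAt ℝ 1 y z.2) :
    derivSnd (fun z => F (x z.1, y z.2)) =ᶠ[𝓝 z]
      fun z => fderiv ℝ F (x z.1, y z.2) (0, deriv y z.2) := by
  filter_upwards [eventually_comp_curves hF (by simp) hx hy (by simp)] with z' hz
  exact derivSnd_comp_curves (hz.1.differentiableAt (by simp)) (hz.2.2.differentiableAt (by simp))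

lemma derivSnd_derivFst_comp_curves {F : V × V → ℝ} {x y : ℝ → V} {z : ℝ × ℝ}
    (hF : ContDiffAt ℝ 2 F (x z.1, y z.2)) (hx : ContDiffAt ℝ 1 x z.1)
    (hy : ContDiffAt ℝ 1 y z.2) :
    derivSnd (derivFst (fun z => F (x z.1, y z.2))) z =
      fderiv ℝ (fderiv ℝ F) (x z.1, y z.2) (0, deriv y z.2) (deriv x z.1, 0) := by
  rw [derivSnd_congr_at (derivFst_comp_curves_eventuallyEq (hF.of_le (by norm_num)) hx hy)]
  have h1 : HasDerivAt (fun t => fderiv ℝ F (x z.1, y t))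
      (fderiv ℝ (fderiv ℝ F) (x z.1, y z.2) (0, deriv y z.2)) z.2 :=
    ((hF.fderiv_right (m := 1) (by norm_num)).differentiableAt
      (by simp)).hasFDerivAt.comp_hasDerivAt z.2 ((hasDerivAt_const z.2 (x z.1)).prodMk
        (hy.differentiableAt (by simp)).hasDerivAt)
  have h2 := (h1.clm_apply (hasDerivAt_const z.2 ((deriv x z.1, 0) : V × V))).deriv
  simp only [map_zero, add_zero] at h2
  exact h2

lemma contDiffAt_derivSnd_derivFst_comp_curves {F : V × V → ℝ} {x y : ℝ → V} {z : ℝ × ℝ}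
    (hF : ContDiffAt ℝ 4 F (x z.1, y z.2)) (hx : ContDiffAt ℝ 3 x z.1)
    (hy : ContDiffAt ℝ 3 y z.2) :
    ContDiffAt ℝ 2 (derivSnd (derivFst (fun z => F (x z.1, y z.2)))) z := by
  have hF2 : ContDiffAt ℝ 2 (fderiv ℝ (fderiv ℝ F)) (x z.1, y z.2) :=
    (hF.fderiv_right (m := 3) (by norm_num)).fderiv_right (by norm_num)
  have hx' : ContDiffAt ℝ 2 (fun z : ℝ × ℝ => deriv x z.1) z :=
    (hx.derivWithin (m := 2) (by norm_num)).comp z contDiffAt_fst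
  have hy' : ContDiffAt ℝ 2 (fun z : ℝ × ℝ => deriv y z.2) z :=
    (hy.derivWithin (m := 2) (by norm_num)).comp z contDiffAt_snd
  refine ContDiffAt.congr_of_eventuallyEq (((contDiffAt_comp_curves hF2
    (hx.of_le (by norm_num)) (hy.of_le (by norm_num))).clm_apply
      ((contDiffAt_const (c := (0 : V))).prodMk hy')).clm_apply
        (hx'.prodMk (contDiffAt_const (c := (0 : V))))) ?_
  filter_upwards [eventually_comp_curves hF (by simp) hx hy (by simp)] with z' hz
  exact derivSnd_derivFst_comp_curves (hz.1.of_le (by norm_num)) (hz.2.1.of_le (by norm_num))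
    (hz.2.2.of_le (by norm_num))

lemma derivFst_derivFst_comp_curves {F : V × V → ℝ} {x y : ℝ → V} {z : ℝ × ℝ}
    (hF : ContDiffAt ℝ 2 F (x z.1, y z.2)) (hx : ContDiffAt ℝ 2 x z.1)
    (hy : ContDiffAt ℝ 1 y z.2) :
    derivFst (derivFst (fun z => F (x z.1, y z.2))) z =
      fderiv ℝ (fderiv ℝ F) (x z.1, y z.2) (deriv x z.1, 0) (deriv x z.1, 0)
        + fderiv ℝ F (x z.1, y z.2) (deriv (deriv x) z.1, 0) := by
  rw [derivFst_congr_at (derivFst_comp_curves_eventuallyEq (hF.of_le (by norm_num))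
    (hx.of_le (by norm_num)) hy)]
  have h1 : HasDerivAt (fun s => fderiv ℝ F (x s, y z.2))
      (fderiv ℝ (fderiv ℝ F) (x z.1, y z.2) (deriv x z.1, 0)) z.1 :=
    ((hF.fderiv_right (m := 1) (by norm_num)).differentiableAt
      (by simp)).hasFDerivAt.comp_hasDerivAt z.1
        ((hx.differentiableAt (by simp)).hasDerivAt.prodMk (hasDerivAt_const z.1 (y z.2)))
  have h2 : HasDerivAt (deriv x) (deriv (deriv x) z.1) z.1 :=
    ((hx.derivWithin (m := 1) (by norm_num)).differentiableAt (by simp)).hasDerivAt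
  exact (h1.clm_apply (h2.prodMk (hasDerivAt_const z.1 (0 : V)))).deriv

/-- If the curve `x` is a `c*`-segment with respect to `y t` and `γ` is a `c`-segment with respect
to `x s` that is tangent to `y` at `t`, then the mixed fourth order derivative of `F` along
`(x, y)` is the second derivative of the Hessian in the first variable along `γ`. -/
lemma derivFst_derivFst_derivSnd_derivSnd_comp_curves {F : V × V → ℝ} {x y γ : ℝ → V} {s t : ℝ}
    (hF : ContDiffAt ℝ 4 F (x s, y t)) (hx : ContDiffAt ℝ 3 x s) (hy : ContDiffAt ℝ 3 y t)
    (hγ : ContDiffAt ℝ 2 γ 0) (hγ0 : γ 0 = y t) (hγ' : deriv γ 0 = deriv y t)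
    (hxseg : ∀ v : V, ∃ a b : ℝ, ∀ᶠ s' in 𝓝 s, fderiv ℝ F (x s', y t) (0, v) = a + s' * b)
    (hγseg : ∀ v : V, ∃ a b : ℝ, ∀ᶠ τ in 𝓝 0, fderiv ℝ F (x s, γ τ) (v, 0) = a + τ * b) :
    derivFst (derivFst (derivSnd (derivSnd (fun z => F (x z.1, y z.2))))) (s, t) =
      deriv (deriv fun τ =>
        fderiv ℝ (fderiv ℝ F) (x s, γ τ) (deriv x s, 0) (deriv x s, 0)) 0 := by
  set Q : V → ℝ := fun y => fderiv ℝ (fderiv ℝ F) (x s, y) (deriv x s, 0) (deriv x s, 0) with hQ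
  set L : V → ℝ := fun y => fderiv ℝ F (x s, y) (deriv (deriv x) s, 0) with hL
  have hpair : ContDiffAt ℝ 2 (fun y : V => (x s, y)) (y t) := contDiffAt_const.prodMk contDiffAt_id
  have hQc : ContDiffAt ℝ 2 Q (y t) := by
    have hF2 : ContDiffAt ℝ 2 (fderiv ℝ (fderiv ℝ F)) (x s, y t) :=
      (hF.fderiv_right (m := 3) (by norm_num)).fderiv_right (by norm_num)
    exact ((ContDiffAt.comp (y t) hF2 hpair).clm_apply contDiffAt_const).clm_apply contDiffAt_const
  have hLc : ContDiffAt ℝ 2 L (y t) := by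
    have hF1 : ContDiffAt ℝ 2 (fderiv ℝ F) (x s, y t) := hF.fderiv_right (by norm_num)
    exact (ContDiffAt.comp (y t) hF1 hpair).clm_apply contDiffAt_const
  have hWc : ContDiffAt ℝ 2 (fun y => Q y + L y) (y t) := hQc.add hLc
  have hcurve : ∀ {κ : ℝ → V} {r : ℝ}, κ r = y t → ContDiffAt ℝ 3 κ r →
      ∀ᶠ r' in 𝓝 r, derivFst (derivFst (fun z => F (x z.1, κ z.2))) (s, r') = Q (κ r') + L (κ r') := by
    intro κ r hκ hκc
    have := (tendsto_prodMk_right_nhds (s, r)).eventually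
      (eventually_comp_curves (z := (s, r)) (by simpa only [hκ] using hF) (by simp) hx hκc (by simp))
    filter_upwards [this] with r' hr'
    exact derivFst_derivFst_comp_curves (z := (s, r')) (hr'.1.of_le (by norm_num))
      (hx.of_le (by norm_num)) (hr'.2.2.of_le (by norm_num))
  have hcrit : fderiv ℝ (fun y => Q y + L y) (y t) = 0 := by
    ext v
    have hκ : HasDerivAt (fun r : ℝ => y t + r • v) v 0 := by
      simpa using ((hasDerivAt_id (0 : ℝ)).smul_const v).const_add (y t)
    have hκc : ContDiffAt ℝ 3 (fun r : ℝ => y t + r • v) 0 := by fun_prop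
    have hκ0 : y t + (0 : ℝ) • v = y t := by simp
    have hF' : ContDiffAt ℝ 4 F (x s, y t + (0 : ℝ) • v) := by simpa only [hκ0] using hF
    have hH : ContDiffAt ℝ 3 (fun z : ℝ × ℝ => F (x z.1, y t + z.2 • v)) (s, 0) :=
      contDiffAt_comp_curves (y := fun r : ℝ => y t + r • v) (z := (s, 0))
        (hF'.of_le (by norm_num)) hx hκc
    have h1 := (derivFst_derivFst_derivSnd hH).eq_of_nhds
    have h2 : derivSnd (derivFst (derivFst fun z : ℝ × ℝ => F (x z.1, y t + z.2 • v))) (s, 0)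
        = fderiv ℝ (fun y => Q y + L y) (y t) v := by
      have h3 : HasDerivAt (fun r : ℝ => Q (y t + r • v) + L (y t + r • v))
          (fderiv ℝ (fun y => Q y + L y) (y t) v) 0 := by
        have := (hWc.differentiableAt (by simp)).hasFDerivAt
        rw [← hκ0] at this
        have := this.comp_hasDerivAt (0 : ℝ) hκ
        rwa [hκ0] at this
      exact (Filter.EventuallyEq.deriv_eq (hcurve hκ0 hκc)).trans h3.deriv
    rw [← h2, ← h1]
    refine (deriv_deriv_eq_zero_of_affine ?_ : deriv (deriv fun s' =>
      derivSnd (fun z : ℝ × ℝ => F (x z.1, y t + z.2 • v)) (s', 0)) s = 0)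
    obtain ⟨a, b, hab⟩ := hxseg v
    refine ⟨a, b, ?_⟩
    have := (tendsto_prodMk_left_nhds (s, 0)).eventually
      (derivSnd_comp_curves_eventuallyEq (y := fun r : ℝ => y t + r • v) (z := (s, 0))
        (hF'.of_le (by norm_num)) (hx.of_le (by norm_num)) (hκc.of_le (by norm_num)))
    filter_upwards [this, hab] with s' h4 h5
    rw [h4, ← h5]
    simp [hκ.deriv]
  have hleft := derivFst_derivFst_derivSnd_derivSnd (z := (s, t))
    (contDiffAt_comp_curves (hF.of_le (by norm_num)) hx hy)
    (contDiffAt_derivSnd_derivFst_comp_curves hF hx hy)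
  rw [hleft]
  have hW1 : derivSnd (derivSnd (derivFst (derivFst fun z => F (x z.1, y z.2)))) (s, t)
      = deriv (deriv fun r => Q (y r) + L (y r)) t :=
    (Filter.EventuallyEq.deriv (hcurve rfl hy)).deriv_eq
  have hy1 := deriv_deriv_comp hWc (hy.of_le (by norm_num))
  have hγ1 := deriv_deriv_comp (by rw [hγ0]; exact hWc) hγ
  rw [hW1, hy1, ← hγ', ← hγ0]
  rw [hγ0, hcrit, zero_apply, ← hγ0] at hγ1 ⊢
  rw [← hγ1]
  have hQγ : ContDiffAt ℝ 2 (fun τ => Q (γ τ)) 0 :=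
    ContDiffAt.comp (0 : ℝ) (g := Q) (by rw [hγ0]; exact hQc) hγ
  have hLγ : ContDiffAt ℝ 2 (fun τ => L (γ τ)) 0 :=
    ContDiffAt.comp (0 : ℝ) (g := L) (by rw [hγ0]; exact hLc) hγ
  have hsum : deriv (fun τ => Q (γ τ) + L (γ τ)) =ᶠ[𝓝 0]
      fun τ => deriv (fun τ => Q (γ τ)) τ + deriv (fun τ => L (γ τ)) τ := by
    filter_upwards [eventually_differentiableAt (hQγ.of_le (by norm_num)),
      eventually_differentiableAt (hLγ.of_le (by norm_num))] with τ h1 h2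
    exact deriv_fun_add h1 h2
  rw [hsum.deriv_eq, deriv_fun_add
    ((hQγ.derivWithin (m := 1) (by norm_num)).differentiableAt (by simp))
    ((hLγ.derivWithin (m := 1) (by norm_num)).differentiableAt (by simp)),
    deriv_deriv_eq_zero_of_affine (hγseg _), add_zero]

end CrossDifference
lemma hasFDerivAt_comp_prodMk_left {V W : Type*} [NormedAddCommGroup V] [NormedSpace ℝ V]
    [NormedAddCommGroup W] [NormedSpace ℝ W] {G : V × V → W} {G' : V × V →L[ℝ] W} {x y : V}
    (h : HasFDerivAt G G' (x, y)) :
    HasFDerivAt (fun x' => G (x', y)) (G'.comp (ContinuousLinearMap.inl ℝ V V)) x :=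
  HasFDerivAt.comp x (f := fun x' => (x', y)) h (hasFDerivAt_prodMk_left x y)

lemma hasFDerivAt_comp_prodMk_right {V W : Type*} [NormedAddCommGroup V] [NormedSpace ℝ V]
    [NormedAddCommGroup W] [NormedSpace ℝ W] {G : V × V → W} {G' : V × V →L[ℝ] W} {x y : V}
    (h : HasFDerivAt G G' (x, y)) :
    HasFDerivAt (fun y' => G (x, y')) (G'.comp (ContinuousLinearMap.inr ℝ V V)) y :=
  HasFDerivAt.comp y (f := fun y' => (x, y')) h (hasFDerivAt_prodMk_right x y)

/-- The inverse on an open set of an injective map with injective derivative is smooth. -/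
lemma contDiffAt_invFunOn {V : Type*} [NormedAddCommGroup V] [NormedSpace ℝ V]
    [FiniteDimensional ℝ V] {Φ : V → V} {U : Set V} {u : V} {k : WithTop ℕ∞} (hU : IsOpen U)
    (hu : u ∈ U) (hΦ : ContDiffAt ℝ k Φ u) (hk : k ≠ 0) (hinj : InjOn Φ U)
    (hder : Function.Injective (fderiv ℝ Φ u)) :
    ContDiffAt ℝ k (Function.invFunOn Φ U) (Φ u) ∧ Φ '' U ∈ 𝓝 (Φ u) := by
  have : CompleteSpace V := FiniteDimensional.complete ℝ V
  have : Nonempty V := ⟨u⟩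
  let e : V ≃L[ℝ] V :=
    (LinearEquiv.ofInjectiveEndo (fderiv ℝ Φ u : V →ₗ[ℝ] V) hder).toContinuousLinearEquiv
  have he : (e : V →L[ℝ] V) = fderiv ℝ Φ u := by ext v; rfl
  have hf' : HasFDerivAt Φ (e : V →L[ℝ] V) u := by
    rw [he]; exact (hΦ.differentiableAt hk).hasFDerivAt
  have hs : HasStrictFDerivAt Φ (e : V →L[ℝ] V) u := hΦ.hasStrictFDerivAt' hf' hk
  have hev : ∀ᶠ z in 𝓝 (Φ u), hs.localInverse Φ e u z ∈ U ∧ Φ (hs.localInverse Φ e u z) = z :=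
    (hs.localInverse_tendsto.eventually (hU.mem_nhds hu)).and hs.eventually_right_inverse
  refine ⟨(hΦ.to_localInverse hf' hk).congr_of_eventuallyEq ?_,
    hev.mono fun z hz => ⟨_, hz.1, hz.2⟩⟩
  filter_upwards [hev] with z hz
  have hz' : ∃ a ∈ U, Φ a = z := ⟨_, hz.1, hz.2⟩
  exact hinj (Function.invFunOn_mem hz') hz.1 ((Function.invFunOn_eq hz').trans hz.2.symm)

/-- The function `(x, y) ↦ -c(x, y)` on the product space. -/
def negCost (c : E → E → ℝ) (q : E × E) : ℝ := -(c q.1 q.2)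

lemma inner_negGradX {c : E → E → ℝ} {x y : E}
    (h : DifferentiableAt ℝ (negCost c) (x, y)) (v : E) :
    ⟪negGradX c x y, v⟫ = fderiv ℝ (negCost c) (x, y) (v, 0) := by
  have h1 : HasFDerivAt (fun x' => negCost c (x', y))
      ((fderiv ℝ (negCost c) (x, y)).comp (ContinuousLinearMap.inl ℝ E E)) x :=
    hasFDerivAt_comp_prodMk_left h.hasFDerivAt
  have h2 : HasFDerivAt (fun x' => c x' y)
      (-((fderiv ℝ (negCost c) (x, y)).comp (ContinuousLinearMap.inl ℝ E E))) x := by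
    simpa only [negCost, neg_neg] using h1.fun_neg
  have h3 : ⟪gradient (fun x' => c x' y) x, v⟫ = fderiv ℝ (fun x' => c x' y) x v :=
    InnerProductSpace.toDual_symm_apply
  rw [negGradX, inner_neg_left, h3, h2.fderiv]
  simp

lemma inner_negGradY {c : E → E → ℝ} {x y : E}
    (h : DifferentiableAt ℝ (negCost c) (x, y)) (v : E) :
    ⟪negGradY c x y, v⟫ = fderiv ℝ (negCost c) (x, y) (0, v) := by
  have h1 : HasFDerivAt (fun y' => negCost c (x, y'))
      ((fderiv ℝ (negCost c) (x, y)).comp (ContinuousLinearMap.inr ℝ E E)) y :=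
    hasFDerivAt_comp_prodMk_right h.hasFDerivAt
  have h2 : HasFDerivAt (fun y' => c x y')
      (-((fderiv ℝ (negCost c) (x, y)).comp (ContinuousLinearMap.inr ℝ E E))) y := by
    simpa only [negCost, neg_neg] using h1.fun_neg
  have h3 : ⟪gradient (fun y' => c x y') y, v⟫ = fderiv ℝ (fun y' => c x y') y v :=
    InnerProductSpace.toDual_symm_apply
  rw [negGradY, inner_neg_left, h3, h2.fderiv]
  simp

lemma contDiffAt_negGradX {c : E → E → ℝ} {x y : E}
    {m k : WithTop ℕ∞} (h : ContDiffAt ℝ k (negCost c) (x, y))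
    (hmk : m + 1 ≤ k) : ContDiffAt ℝ m (fun q : E × E => negGradX c q.1 q.2) (x, y) := by
  have h1 : ContDiffAt ℝ 1 (negCost c) (x, y) := h.of_le (le_trans (by simp) hmk)
  have h2 : ContDiffAt ℝ m (fun q : E × E => (InnerProductSpace.toDual ℝ E).symm
      ((fderiv ℝ (negCost c) q).comp (ContinuousLinearMap.inl ℝ E E))) (x, y) :=
    (InnerProductSpace.toDual ℝ E).symm.contDiff.contDiffAt.comp _
      ((h.fderiv_right hmk).clm_comp contDiffAt_const)
  refine h2.congr_of_eventuallyEq ?_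
  filter_upwards [eventually_differentiableAt h1] with q hq
  refine ext_inner_right ℝ fun v => ?_
  rw [inner_negGradX hq, InnerProductSpace.toDual_symm_apply]
  rfl

lemma contDiffAt_negCost_cStar {c : E → E → ℝ} {x y : E}
    {k : WithTop ℕ∞} (h : ContDiffAt ℝ k (negCost c) (x, y)) :
    ContDiffAt ℝ k (negCost (cStar c)) (y, x) :=
  ContDiffAt.comp (y, x) (g := negCost c) (f := fun q : E × E => (q.2, q.1)) h
    (contDiffAt_snd.prodMk contDiffAt_fst)

lemma contDiffAt_negGradY {c : E → E → ℝ} {x y : E}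
    {m k : WithTop ℕ∞} (h : ContDiffAt ℝ k (negCost c) (x, y))
    (hmk : m + 1 ≤ k) : ContDiffAt ℝ m (fun q : E × E => negGradY c q.1 q.2) (x, y) :=
  ContDiffAt.comp (x, y) (g := fun q : E × E => negGradX (cStar c) q.1 q.2)
    (f := fun q : E × E => (q.2, q.1)) (contDiffAt_negGradX (contDiffAt_negCost_cStar h) hmk)
    (contDiffAt_snd.prodMk contDiffAt_fst)

lemma inner_fderiv_negGradX {c : E → E → ℝ} {x y : E}
    (h : ContDiffAt ℝ 2 (negCost c) (x, y)) (v w : E) :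
    ⟪fderiv ℝ (fun y' => negGradX c x y') y v, w⟫
      = fderiv ℝ (fderiv ℝ (negCost c)) (x, y) (0, v) (w, 0) := by
  have hN : DifferentiableAt ℝ (fun y' => negGradX c x y') y :=
    (hasFDerivAt_comp_prodMk_right ((contDiffAt_negGradX h (m := 1)
      (by norm_num)).differentiableAt (by simp)).hasFDerivAt).differentiableAt
  have hD : HasFDerivAt (fderiv ℝ (negCost c)) (fderiv ℝ (fderiv ℝ (negCost c)) (x, y)) (x, y) :=
    ((h.fderiv_right (m := 1) (by norm_num)).differentiableAt (by simp)).hasFDerivAt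
  have h1 := hN.hasFDerivAt.inner ℝ (hasFDerivAt_const w y)
  have h2 := (hasFDerivAt_comp_prodMk_right hD).clm_apply
    (hasFDerivAt_const ((w, 0) : E × E) y)
  have hev : (fun y' => ⟪negGradX c x y', w⟫) =ᶠ[𝓝 y]
      fun y' => fderiv ℝ (negCost c) (x, y') (w, 0) := by
    have hc : ContinuousAt (fun y' : E => (x, y')) y := by fun_prop
    filter_upwards [hc.eventually (eventually_differentiableAt (h.of_le (by norm_num)))] with y' hy'
    exact inner_negGradX hy' w
  have h3 := congrArg (fun L => L v) (h1.unique (h2.congr_of_eventuallyEq hev))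
  simpa using h3

lemma inner_fderiv_negGradY {c : E → E → ℝ} {x y : E}
    (h : ContDiffAt ℝ 2 (negCost c) (x, y)) (v w : E) :
    ⟪fderiv ℝ (fun x' => negGradY c x' y) x v, w⟫
      = fderiv ℝ (fderiv ℝ (negCost c)) (x, y) (v, 0) (0, w) := by
  have hN : DifferentiableAt ℝ (fun x' => negGradY c x' y) x :=
    (hasFDerivAt_comp_prodMk_left ((contDiffAt_negGradY h (m := 1)
      (by norm_num)).differentiableAt (by simp)).hasFDerivAt).differentiableAt
  have hD : HasFDerivAt (fderiv ℝ (negCost c)) (fderiv ℝ (fderiv ℝ (negCost c)) (x, y)) (x, y) :=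
    ((h.fderiv_right (m := 1) (by norm_num)).differentiableAt (by simp)).hasFDerivAt
  have h1 := hN.hasFDerivAt.inner ℝ (hasFDerivAt_const w x)
  have h2 := (hasFDerivAt_comp_prodMk_left hD).clm_apply
    (hasFDerivAt_const ((0, w) : E × E) x)
  have hev : (fun x' => ⟪negGradY c x' y, w⟫) =ᶠ[𝓝 x]
      fun x' => fderiv ℝ (negCost c) (x', y) (0, w) := by
    have hc : ContinuousAt (fun x' : E => (x', y)) x := by fun_prop
    filter_upwards [hc.eventually (eventually_differentiableAt (h.of_le (by norm_num)))] with x' hx'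
    exact inner_negGradY hx' w
  have h3 := congrArg (fun L => L v) (h1.unique (h2.congr_of_eventuallyEq hev))
  simpa using h3

/-- The regularity, twist and nondegeneracy of a cost on a pair of open domains, in a form that is
invariant under exchanging the two variables. -/
structure IsTwistedCost (c : E → E → ℝ) (Ω Λ : Set E) : Prop where
  isOpen_source : IsOpen Ω
  isOpen_target : IsOpen Λ
  contDiffAt : ∀ x ∈ Ω, ∀ y ∈ Λ, ContDiffAt ℝ 4 (negCost c) (x, y)
  injOn_negGradX : ∀ x ∈ Ω, InjOn (fun y => negGradX c x y) Λ
  injOn_negGradY : ∀ y ∈ Λ, InjOn (fun x => negGradY c x y) Ω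
  injective_fderiv_negGradX : ∀ x ∈ Ω, ∀ y ∈ Λ,
    Function.Injective (fderiv ℝ (fun y' => negGradX c x y') y)
  injective_fderiv_negGradY : ∀ x ∈ Ω, ∀ y ∈ Λ,
    Function.Injective (fderiv ℝ (fun x' => negGradY c x' y) x)

lemma isTwistedCost_of_conditions {c : E → E → ℝ} {Ω Λ : Set E}
    (hΩ : IsOpen Ω) (hΛ : IsOpen Λ) (h0 : A0 c Ω Λ)
    (h1 : A1 c Ω Λ) (h2 : A2 c Ω Λ) : IsTwistedCost c Ω Λ := by
  have hC : ∀ x ∈ Ω, ∀ y ∈ Λ, ContDiffAt ℝ 4 (negCost c) (x, y) := fun x hx y hy =>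
    ContDiffAt.neg (h0.contDiffAt (Filter.mem_of_superset
      ((hΩ.prod hΛ).mem_nhds (show (x, y) ∈ Ω ×ˢ Λ from ⟨hx, hy⟩))
      (prod_mono subset_closure subset_closure)))
  refine ⟨hΩ, hΛ, hC, fun x hx => (h1.1 x hx).mono subset_closure,
    fun y hy => (h1.2 y hy).mono subset_closure,
    fun x hx y hy => (h2 x (subset_closure hx) y (subset_closure hy)).1, fun x hx y hy => ?_⟩
  rw [injective_iff_map_eq_zero]
  intro v hv
  have hC2 : ContDiffAt ℝ 2 (negCost c) (x, y) := (hC x hx y hy).of_le (by norm_num)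
  obtain ⟨w, hw⟩ := (h2 x (subset_closure hx) y (subset_closure hy)).2 v
  rw [← inner_self_eq_zero (𝕜 := ℝ)]
  nth_rewrite 1 [← hw]
  rw [inner_fderiv_negGradX hC2, (hC2.isSymmSndFDerivAt (by simp)).eq, ← inner_fderiv_negGradY hC2,
    hv, inner_zero_left]

namespace IsTwistedCost

lemma swap {c : E → E → ℝ} {Ω Λ : Set E}
    (hc : IsTwistedCost c Ω Λ) : IsTwistedCost (cStar c) Λ Ω :=
  ⟨hc.isOpen_target, hc.isOpen_source,
    fun y hy x hx => contDiffAt_negCost_cStar (hc.contDiffAt x hx y hy),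
    hc.injOn_negGradY, hc.injOn_negGradX,
    fun y hy x hx => hc.injective_fderiv_negGradY x hx y hy,
    fun y hy x hx => hc.injective_fderiv_negGradX x hx y hy⟩

lemma cExp_negGradX {c : E → E → ℝ} {Ω Λ : Set E} {x y : E}
    (hc : IsTwistedCost c Ω Λ) (hx : x ∈ Ω) (hy : y ∈ Λ) :
    cExp c Λ x (negGradX c x y) = y :=
  (hc.injOn_negGradX x hx).leftInvOn_invFunOn hy

lemma contDiffAt_cExp {c : E → E → ℝ} {Ω Λ : Set E} {x y : E}
    (hc : IsTwistedCost c Ω Λ) (hx : x ∈ Ω) (hy : y ∈ Λ) :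
    ContDiffAt ℝ 3 (fun q : E × E => cExp c Λ q.1 q.2) (x, negGradX c x y) ∧
      ∀ᶠ q : E × E in 𝓝 (x, negGradX c x y), q.1 ∈ Ω ∧ q.2 ∈ cExpDom c Λ q.1 := by
  set Φ : E × E → E × E := fun q => (q.1, negGradX c q.1 q.2) with hΦ
  have hN : ContDiffAt ℝ 3 (fun q : E × E => negGradX c q.1 q.2) (x, y) :=
    contDiffAt_negGradX (hc.contDiffAt x hx y hy) (by norm_num)
  have hNd := (hN.differentiableAt (by simp)).hasFDerivAt
  have hΦc : ContDiffAt ℝ 3 Φ (x, y) := contDiffAt_fst.prodMk hN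
  have hinj : InjOn Φ (Ω ×ˢ Λ) := by
    rintro ⟨a, b⟩ ⟨ha, hb⟩ ⟨a', b'⟩ ⟨_, hb'⟩ hab
    obtain ⟨h1, h2⟩ := Prod.ext_iff.1 hab
    simp only [hΦ] at h1 h2
    subst h1
    exact Prod.ext rfl (hc.injOn_negGradX a ha hb hb' h2)
  have hder : Function.Injective (fderiv ℝ Φ (x, y)) := by
    rw [injective_iff_map_eq_zero]
    rintro ⟨a, b⟩ hab
    rw [(hasFDerivAt_fst.prodMk hNd).fderiv] at hab
    obtain ⟨h1, h2⟩ := Prod.ext_iff.1 hab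
    simp only [ContinuousLinearMap.prod_apply, ContinuousLinearMap.coe_fst', Prod.fst_zero,
      Prod.snd_zero] at h1 h2
    subst h1
    have h3 : fderiv ℝ (fun y' => negGradX c x y') y b = 0 := by
      rw [(hasFDerivAt_comp_prodMk_right hNd).fderiv]
      simpa using h2
    rw [(injective_iff_map_eq_zero _).1 (hc.injective_fderiv_negGradX x hx y hy) b h3]
    rfl
  obtain ⟨h1, h2⟩ := contDiffAt_invFunOn (hc.isOpen_source.prod hc.isOpen_target)
    (show (x, y) ∈ Ω ×ˢ Λ from ⟨hx, hy⟩) hΦc (by simp) hinj hder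
  refine ⟨(contDiffAt_snd.comp _ h1).congr_of_eventuallyEq ?_, ?_⟩
  · filter_upwards [h2]
    rintro _ ⟨⟨a, b⟩, ⟨ha, hb⟩, rfl⟩
    have h3 := hinj.leftInvOn_invFunOn (show (a, b) ∈ Ω ×ˢ Λ from ⟨ha, hb⟩)
    exact (hc.cExp_negGradX ha hb).trans (congrArg Prod.snd h3).symm
  · filter_upwards [h2]
    rintro _ ⟨⟨a, b⟩, ⟨ha, hb⟩, rfl⟩
    exact ⟨ha, b, hb, rfl⟩

end IsTwistedCost

lemma cExp_mem {c : E → E → ℝ} {Λ : Set E} {x : E}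
    {p : E} (hp : p ∈ cExpDom c Λ x) : cExp c Λ x p ∈ Λ :=
  Function.invFunOn_mem hp

lemma negGradX_cExp {c : E → E → ℝ} {Λ : Set E} {x : E}
    {p : E} (hp : p ∈ cExpDom c Λ x) : negGradX c x (cExp c Λ x p) = p :=
  Function.invFunOn_eq hp
/-- The Hessian of `-c` in its first variable, as a function of `(x, p, η)` where `p` is the
covector corresponding to the second variable. -/
def hessianAlongExp (c : E → E → ℝ) (Λ : Set E) (q : E × E × E) : ℝ :=
  fderiv ℝ (fderiv ℝ (negCost c)) (q.1, cExp c Λ q.1 q.2.1) (q.2.2, 0) (q.2.2, 0)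

lemma iteratedFDeriv_two_cost {c : E → E → ℝ} {x y : E} (h : ContDiffAt ℝ 2 (negCost c) (x, y))
    (η : E) : -(iteratedFDeriv ℝ 2 (fun x' => c x' y) x ![η, η]) =
      fderiv ℝ (fderiv ℝ (negCost c)) (x, y) (η, 0) (η, 0) := by
  have hD : HasFDerivAt (fderiv ℝ (negCost c)) (fderiv ℝ (fderiv ℝ (negCost c)) (x, y)) (x, y) :=
    ((h.fderiv_right (m := 1) (by norm_num)).differentiableAt (by simp)).hasFDerivAt
  have hev : fderiv ℝ (fun x' => c x' y) =ᶠ[𝓝 x]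
      fun x' => -((fderiv ℝ (negCost c) (x', y)).comp (ContinuousLinearMap.inl ℝ E E)) := by
    have hc : ContinuousAt (fun x' : E => (x', y)) x := by fun_prop
    filter_upwards [hc.eventually (eventually_differentiableAt (h.of_le (by norm_num)))] with x' hx'
    have h1 := (hasFDerivAt_comp_prodMk_left hx'.hasFDerivAt).fun_neg
    simp only [negCost, neg_neg] at h1
    exact h1.fderiv
  have h2 := ((hasFDerivAt_comp_prodMk_left hD).clm_comp
    (hasFDerivAt_const (ContinuousLinearMap.inl ℝ E E) x)).fun_neg
  rw [iteratedFDeriv_two_apply, hev.fderiv_eq, h2.fderiv]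
  simp

namespace IsTwistedCost

lemma eventually_line_mem_cExpDom {c : E → E → ℝ} {Ω Λ : Set E} {x y : E}
    (hc : IsTwistedCost c Ω Λ) (hx : x ∈ Ω) (hy : y ∈ Λ) (ξ : E) :
    ∀ᶠ τ : ℝ in 𝓝 0, negGradX c x y + τ • ξ ∈ cExpDom c Λ x := by
  have h1 : Tendsto (fun τ : ℝ => (x, negGradX c x y + τ • ξ)) (𝓝 0) (𝓝 (x, negGradX c x y)) := by
    have : ContinuousAt (fun τ : ℝ => (x, negGradX c x y + τ • ξ)) 0 := by fun_prop
    simpa [ContinuousAt] using this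
  exact (h1.eventually (hc.contDiffAt_cExp hx hy).2).mono fun _ h => h.2

lemma contDiffAt_cExp_line {c : E → E → ℝ} {Ω Λ : Set E} {x y : E}
    (hc : IsTwistedCost c Ω Λ) (hx : x ∈ Ω) (hy : y ∈ Λ) (ξ : E) :
    ContDiffAt ℝ 3 (fun τ : ℝ => cExp c Λ x (negGradX c x y + τ • ξ)) 0 := by
  have h1 : ContDiffAt ℝ 3 (fun τ : ℝ => (x, negGradX c x y + τ • ξ)) 0 := by fun_prop
  exact ContDiffAt.comp (0 : ℝ) (g := fun q : E × E => cExp c Λ q.1 q.2)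
    (by simpa using (hc.contDiffAt_cExp hx hy).1) h1

lemma cSectional_eq {c : E → E → ℝ} {Ω Λ : Set E} {x y : E}
    (hc : IsTwistedCost c Ω Λ) (hx : x ∈ Ω) (hy : y ∈ Λ) (η ξ : E) :
    cSectional c Λ x y η ξ = deriv (deriv fun τ : ℝ =>
      fderiv ℝ (fderiv ℝ (negCost c)) (x, cExp c Λ x (negGradX c x y + τ • ξ)) (η, 0) (η, 0)) 0 := by
  refine Filter.EventuallyEq.deriv_eq (Filter.EventuallyEq.deriv ?_)
  filter_upwards [hc.eventually_line_mem_cExpDom hx hy ξ] with τ hτ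
  exact iteratedFDeriv_two_cost ((hc.contDiffAt x hx _ (cExp_mem hτ)).of_le (by norm_num)) η

lemma contDiffAt_hessianAlongExp {c : E → E → ℝ} {Ω Λ : Set E} {x y : E}
    (hc : IsTwistedCost c Ω Λ) (hx : x ∈ Ω) (hy : y ∈ Λ) (η : E) :
    ContDiffAt ℝ 2 (hessianAlongExp c Λ) (x, negGradX c x y, η) := by
  have h1 : ContDiffAt ℝ 2 (fun q : E × E × E => cExp c Λ q.1 q.2.1) (x, negGradX c x y, η) :=
    ContDiffAt.comp (x, negGradX c x y, η) (g := fun q : E × E => cExp c Λ q.1 q.2)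
      (f := fun q : E × E × E => (q.1, q.2.1))
      ((hc.contDiffAt_cExp hx hy).1.of_le (by norm_num)) (by fun_prop)
  have h2 : ContDiffAt ℝ 2 (fderiv ℝ (fderiv ℝ (negCost c))) (x, y) :=
    ((hc.contDiffAt x hx y hy).fderiv_right (m := 3) (by norm_num)).fderiv_right (by norm_num)
  have h3 : ContDiffAt ℝ 2 (fun q : E × E × E =>
      fderiv ℝ (fderiv ℝ (negCost c)) (q.1, cExp c Λ q.1 q.2.1)) (x, negGradX c x y, η) :=
    ContDiffAt.comp (x, negGradX c x y, η)
      (f := fun q : E × E × E => (q.1, cExp c Λ q.1 q.2.1))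
      (by simpa only [hc.cExp_negGradX hx hy] using h2) (contDiffAt_fst.prodMk h1)
  have h4 : ContDiffAt ℝ 2 (fun q : E × E × E => ((q.2.2, 0) : E × E)) (x, negGradX c x y, η) := by
    fun_prop
  exact (h3.clm_apply h4).clm_apply h4

lemma cSectional_eq_fderiv {c : E → E → ℝ} {Ω Λ : Set E} {x y : E}
    (hc : IsTwistedCost c Ω Λ) (hx : x ∈ Ω) (hy : y ∈ Λ) (η ξ : E) :
    cSectional c Λ x y η ξ = fderiv ℝ (fderiv ℝ (hessianAlongExp c Λ)) (x, negGradX c x y, η)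
      (0, ξ, 0) (0, ξ, 0) := by
  set γ : ℝ → E × E × E := fun τ => (x, negGradX c x y + τ • ξ, η) with hγ
  have hγ0 : γ 0 = (x, negGradX c x y, η) := by simp [hγ]
  have hγ' : deriv γ = fun _ => (0, ξ, 0) := by
    funext τ
    have h1 : HasDerivAt (fun τ : ℝ => negGradX c x y + τ • ξ) ξ τ := by
      simpa using ((hasDerivAt_id τ).smul_const ξ).const_add (negGradX c x y)
    exact ((hasDerivAt_const τ x).prodMk (h1.prodMk (hasDerivAt_const τ η))).deriv
  have h := deriv_deriv_comp (W := hessianAlongExp c Λ) (γ := γ) (t := 0)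
    (by rw [hγ0]; exact hc.contDiffAt_hessianAlongExp hx hy η) (by fun_prop)
  rw [hγ', hγ0, deriv_const, map_zero, add_zero] at h
  rw [hc.cSectional_eq hx hy, ← h]
  rfl

/-- Under (A3W) the `c`-sectional curvature is bounded below by a multiple of the pairing of its
arguments, uniformly on compact sets. -/
lemma exists_cSectional_ge {Z : Type*} [TopologicalSpace Z] {c : E → E → ℝ} {Ω Λ : Set E}
    (hc : IsTwistedCost c Ω Λ) (h3 : A3W c Ω Λ) {K : Set Z} (hK : IsCompact K) {x y η ξ : Z → E}
    (hx : ContinuousOn x K) (hy : ContinuousOn y K) (hη : ContinuousOn η K)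
    (hξ : ContinuousOn ξ K) (hxΩ : ∀ z ∈ K, x z ∈ Ω) (hyΛ : ∀ z ∈ K, y z ∈ Λ)
    (hη0 : ∀ z ∈ K, η z ≠ 0) :
    ∃ C : ℝ, ∀ z ∈ K, -(C * |⟪η z, ξ z⟫|) ≤ cSectional c Λ (x z) (y z) (η z) (ξ z) := by
  set B : Z → (E × E × E) →L[ℝ] (E × E × E) →L[ℝ] ℝ := fun z =>
    fderiv ℝ (fderiv ℝ (hessianAlongExp c Λ)) (x z, negGradX c (x z) (y z), η z) with hB
  set ι : E →L[ℝ] E × E × E :=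
    (ContinuousLinearMap.inr ℝ E (E × E)).comp (ContinuousLinearMap.inl ℝ E E) with hι
  have hιa : ∀ v, ι v = (0, v, 0) := fun v => by simp [hι]
  have hp : ContinuousOn (fun z => negGradX c (x z) (y z)) K := fun z hz =>
    ContinuousAt.comp_continuousWithinAt (g := fun q : E × E => negGradX c q.1 q.2)
      (f := fun z => (x z, y z)) (contDiffAt_negGradX (m := 3)
        (hc.contDiffAt _ (hxΩ z hz) _ (hyΛ z hz)) (by norm_num)).continuousAt
      ((hx z hz).prodMk (hy z hz))
  have hBc : ContinuousOn B K := fun z hz =>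
    ContinuousAt.comp_continuousWithinAt (g := fderiv ℝ (fderiv ℝ (hessianAlongExp c Λ)))
      (f := fun z => (x z, negGradX c (x z) (y z), η z))
      (((hc.contDiffAt_hessianAlongExp (hxΩ z hz) (hyΛ z hz) (η z)).fderiv_right (m := 1)
        (by norm_num)).fderiv_right (m := 0) (by norm_num)).continuousAt
      ((hx z hz).prodMk ((hp z hz).prodMk (hη z hz)))
  have hS : ∀ z ∈ K, ∀ v, cSectional c Λ (x z) (y z) (η z) v = B z (ι v) (ι v) := fun z hz v => by
    rw [hc.cSectional_eq_fderiv (hxΩ z hz) (hyΛ z hz), hιa]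
  have hn : ∀ z ∈ K, ‖η z‖ ^ 2 ≠ 0 := fun z hz => by simpa using hη0 z hz
  set a : Z → ℝ := fun z => ⟪η z, ξ z⟫ / ‖η z‖ ^ 2 with ha
  have hac : ContinuousOn a K := (hη.inner hξ).div (hη.norm.pow 2) hn
  set ζ : Z → E := fun z => ξ z - a z • η z with hζ
  have hζc : ContinuousOn ζ K := hξ.sub (hac.smul hη)
  set R : Z → ℝ := fun z => (B z (ι (ζ z)) (ι (η z)) + B z (ι (η z)) (ι (ζ z))
    + a z * B z (ι (η z)) (ι (η z))) / ‖η z‖ ^ 2 with hR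
  have hRc : ContinuousOn R K := by
    have h1 : ContinuousOn (fun z => ι (ζ z)) K := ι.continuous.comp_continuousOn hζc
    have h2 : ContinuousOn (fun z => ι (η z)) K := ι.continuous.comp_continuousOn hη
    exact ((((hBc.clm_apply h1).clm_apply h2).add ((hBc.clm_apply h2).clm_apply h1)).add
      (hac.mul ((hBc.clm_apply h2).clm_apply h2))).div (hη.norm.pow 2) hn
  obtain ⟨C, hC⟩ := hK.exists_bound_of_continuousOn hRc
  refine ⟨C, fun z hz => ?_⟩
  have horth : ⟪η z, ζ z⟫ = 0 := by
    simp only [hζ, ha]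
    rw [inner_sub_right, inner_smul_right, real_inner_self_eq_norm_sq, div_mul_cancel₀ _ (hn z hz),
      sub_self]
  have h0 : 0 ≤ B z (ι (ζ z)) (ι (ζ z)) := by
    rw [← hS z hz]
    exact h3 _ (hxΩ z hz) _ (hyΛ z hz) _ _ horth
  have hdecomp : B z (ι (ξ z)) (ι (ξ z)) = B z (ι (ζ z)) (ι (ζ z)) + ⟪η z, ξ z⟫ * R z := by
    have h4 : ξ z = ζ z + a z • η z := by simp [hζ]
    have h5 : ⟪η z, ξ z⟫ * R z = a z * (B z (ι (ζ z)) (ι (η z)) + B z (ι (η z)) (ι (ζ z))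
        + a z * B z (ι (η z)) (ι (η z))) := by
      simp only [hR, ha]; ring
    rw [h5, h4]
    simp only [map_add, map_smul, add_apply, smul_apply, smul_eq_mul]
    ring
  rw [hS z hz, hdecomp]
  have h6 : |⟪η z, ξ z⟫ * R z| ≤ C * |⟪η z, ξ z⟫| := by
    rw [abs_mul, mul_comm]
    exact mul_le_mul_of_nonneg_right (hC z hz) (abs_nonneg _)
  linarith [neg_abs_le (⟪η z, ξ z⟫ * R z)]

/-- The mixed fourth order derivative of `-c` along a `c*`-segment and a curve is the
`c`-sectional curvature. -/
lemma derivFst_derivFst_derivSnd_derivSnd_negCost {c : E → E → ℝ} {Ω Λ : Set E}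
    (hc : IsTwistedCost c Ω Λ) {x y : ℝ → E} {s t : ℝ} (hxs : x s ∈ Ω) (hyt : y t ∈ Λ)
    (hx : ContDiffAt ℝ 3 x s) (hy : ContDiffAt ℝ 3 y t)
    (hxseg : ∃ a b : E, ∀ᶠ s' in 𝓝 s, negGradY c (x s') (y t) = a + s' • b) :
    derivFst (derivFst (derivSnd (derivSnd fun z => negCost c (x z.1, y z.2)))) (s, t) =
      cSectional c Λ (x s) (y t) (deriv x s)
        (fderiv ℝ (fun y' => negGradX c (x s) y') (y t) (deriv y t)) := by
  set ξ := fderiv ℝ (fun y' => negGradX c (x s) y') (y t) (deriv y t) with hξ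
  set γ : ℝ → E := fun τ => cExp c Λ (x s) (negGradX c (x s) (y t) + τ • ξ) with hγ
  have hγc : ContDiffAt ℝ 3 γ 0 := hc.contDiffAt_cExp_line hxs hyt ξ
  have hγ0 : γ 0 = y t := by simp [hγ, hc.cExp_negGradX hxs hyt]
  have hmem := hc.eventually_line_mem_cExpDom hxs hyt ξ
  have hN : DifferentiableAt ℝ (fun y' => negGradX c (x s) y') (y t) :=
    (hasFDerivAt_comp_prodMk_right ((contDiffAt_negGradX (m := 3)
      (hc.contDiffAt _ hxs _ hyt) (by norm_num)).differentiableAt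
        (by simp)).hasFDerivAt).differentiableAt
  have hγ' : deriv γ 0 = deriv y t := by
    refine hc.injective_fderiv_negGradX _ hxs _ hyt (?_ : _ = ξ)
    have h1 : HasDerivAt (fun τ => negGradX c (x s) (γ τ))
        (fderiv ℝ (fun y' => negGradX c (x s) y') (y t) (deriv γ 0)) 0 :=
      HasFDerivAt.comp_hasDerivAt (0 : ℝ) (l := fun y' => negGradX c (x s) y') (f := γ)
        (by rw [hγ0]; exact hN.hasFDerivAt) (hγc.differentiableAt (by simp)).hasDerivAt
    have h2 : HasDerivAt (fun τ : ℝ => negGradX c (x s) (y t) + τ • ξ) ξ 0 := by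
      simpa using ((hasDerivAt_id (0 : ℝ)).smul_const ξ).const_add (negGradX c (x s) (y t))
    exact h1.unique (h2.congr_of_eventuallyEq (hmem.mono fun τ hτ => negGradX_cExp hτ))
  rw [hc.cSectional_eq hxs hyt]
  refine derivFst_derivFst_derivSnd_derivSnd_comp_curves (hc.contDiffAt _ hxs _ hyt) hx hy
    (hγc.of_le (by norm_num)) hγ0 hγ' ?_ ?_
  · intro v
    obtain ⟨a, b, hab⟩ := hxseg
    refine ⟨⟪a, v⟫, ⟪b, v⟫, ?_⟩
    filter_upwards [hab, hx.continuousAt.eventually (hc.isOpen_source.mem_nhds hxs)] with s' h1 h2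
    rw [← inner_negGradY ((hc.contDiffAt _ h2 _ hyt).differentiableAt (by simp)), h1,
      inner_add_left, real_inner_smul_left]
  · intro v
    refine ⟨⟪negGradX c (x s) (y t), v⟫, ⟪ξ, v⟫, ?_⟩
    filter_upwards [hmem] with τ hτ
    rw [← inner_negGradX ((hc.contDiffAt _ hxs _ (cExp_mem hτ)).differentiableAt (by simp)),
      negGradX_cExp hτ, inner_add_left, real_inner_smul_left]

end IsTwistedCost

lemma neg_le_sub_of_neg_le_deriv_deriv {g : ℝ → ℝ} {K : ℝ} (hK : 0 ≤ K)
    (hg : ∀ s ∈ Icc (0 : ℝ) 1, DifferentiableAt ℝ g s)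
    (hg' : ∀ s ∈ Icc (0 : ℝ) 1, DifferentiableAt ℝ (deriv g) s) (h0 : 0 ≤ deriv g 0)
    (h2 : ∀ s ∈ Icc (0 : ℝ) 1, -K ≤ deriv (deriv g) s) : -K ≤ g 1 - g 0 := by
  have hmem : (0 : ℝ) ∈ Icc (0 : ℝ) 1 := by simp
  have h1 : ∀ s ∈ Icc (0 : ℝ) 1, -K ≤ deriv g s := fun s hs => by
    have h := (convex_Icc (0 : ℝ) 1).mul_sub_le_image_sub_of_le_deriv
      (fun s hs => (hg' s hs).continuousAt.continuousWithinAt)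
      (fun s hs => (hg' s (interior_subset hs)).differentiableWithinAt)
      (fun s hs => h2 s (interior_subset hs)) 0 hmem s hs hs.1
    nlinarith [mul_nonneg hK (sub_nonneg.2 hs.2)]
  have h := (convex_Icc (0 : ℝ) 1).mul_sub_le_image_sub_of_le_deriv
    (fun s hs => (hg s hs).continuousAt.continuousWithinAt)
    (fun s hs => (hg s (interior_subset hs)).differentiableWithinAt)
    (fun s hs => h1 s (interior_subset hs)) 0 hmem 1 (by simp) zero_le_one
  linarith

/-- A function satisfying `g' ≥ -C |g|` that is nonnegative at some point remains nonnegative. -/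
lemma nonneg_of_neg_mul_abs_le_deriv {g : ℝ → ℝ} {C a b : ℝ} (hab : a ≤ b)
    (hg : ∀ t ∈ Icc a b, DifferentiableAt ℝ g t)
    (hC : ∀ t ∈ Icc a b, -(C * |g t|) ≤ deriv g t) (ha : 0 ≤ g a) : 0 ≤ g b := by
  have hcont : ContinuousOn g (Icc a b) := fun t ht => (hg t ht).continuousAt.continuousWithinAt
  obtain ⟨s, ⟨hs, hgs⟩, hsmax⟩ :=
    (isCompact_Icc.of_isClosed_subset (hcont.preimage_isClosed_of_isClosed isClosed_Icc isClosed_Ici)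
      inter_subset_left).exists_isGreatest ⟨a, left_mem_Icc.2 hab, (ha : g a ∈ Ici 0)⟩
  have hsub : Icc s b ⊆ Icc a b := Icc_subset_Icc_left hs.1
  have hder : ∀ t ∈ Icc s b, HasDerivAt (fun t => Real.exp (-(C * t)) * g t)
      (Real.exp (-(C * t)) * (deriv g t - C * g t)) t := fun t ht => by
    have h1 : HasDerivAt (fun t : ℝ => -(C * t)) (-C) t := by
      simpa using ((hasDerivAt_id t).const_mul C).fun_neg
    refine (h1.exp.fun_mul (hg t (hsub ht)).hasDerivAt).congr_deriv ?_
    ring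
  have hmono : MonotoneOn (fun t => Real.exp (-(C * t)) * g t) (Icc s b) := by
    refine monotoneOn_of_deriv_nonneg (convex_Icc s b)
      (fun t ht => (hder t ht).continuousAt.continuousWithinAt)
      (fun t ht => (hder t (interior_subset ht)).differentiableAt.differentiableWithinAt)
      fun t ht => ?_
    rw [(hder t (interior_subset ht)).deriv]
    rw [interior_Icc] at ht
    have hneg : g t ≤ 0 := by
      by_contra! h
      exact absurd (hsmax ⟨hsub (Ioo_subset_Icc_self ht), h.le⟩) (not_le.2 ht.1)
    have h2 := hC t (hsub (Ioo_subset_Icc_self ht))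
    rw [abs_of_nonpos hneg] at h2
    exact mul_nonneg (Real.exp_pos _).le (by linarith)
  have h3 : Real.exp (-(C * s)) * g s ≤ Real.exp (-(C * b)) * g b :=
    hmono (left_mem_Icc.2 hs.2) (right_mem_Icc.2 hs.2) hs.2
  exact nonneg_of_mul_nonneg_right ((mul_nonneg (Real.exp_pos _).le hgs).trans h3) (Real.exp_pos _)

/-- The `c*`-segment from `x₀` to `x₁` with respect to `y t`, as a function of `z = (s, t)`. -/
def starSeg (c : E → E → ℝ) (Ω : Set E) (y : ℝ → E) (x₀ x₁ : E) (z : ℝ × ℝ) : E :=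
  cExp (cStar c) Ω (y z.2)
    ((1 - z.1) • negGradY c x₀ (y z.2) + z.1 • negGradY c x₁ (y z.2))

namespace IsTwistedCost

lemma contDiffAt_cExp_comp {W : Type*} [NormedAddCommGroup W] [NormedSpace ℝ W]
    {c : E → E → ℝ} {Ω Λ : Set E} (hc : IsTwistedCost c Ω Λ) {u p : W → E} {w : W}
    (hu : ContDiffAt ℝ 3 u w) (hp : ContDiffAt ℝ 3 p w) (huΩ : u w ∈ Ω)
    (hpd : p w ∈ cExpDom c Λ (u w)) :
    ContDiffAt ℝ 3 (fun w => cExp c Λ (u w) (p w)) w ∧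
      ∀ᶠ w' in 𝓝 w, p w' ∈ cExpDom c Λ (u w') := by
  obtain ⟨v, hv, hpv⟩ := hpd
  obtain ⟨h1, h2⟩ := hc.contDiffAt_cExp huΩ hv
  have hpv' : (u w, negGradX c (u w) v) = (u w, p w) := by rw [← hpv]
  rw [hpv'] at h1 h2
  refine ⟨ContDiffAt.comp w (g := fun q : E × E => cExp c Λ q.1 q.2) (f := fun w => (u w, p w))
    h1 (hu.prodMk hp), ?_⟩
  exact ((hu.continuousAt.prodMk hp.continuousAt).eventually h2).mono fun _ h => h.2

lemma ySeg_spec {c : E → E → ℝ} {Ω Λ : Set E} {xm y₀ y₁ : E} {θ : ℝ}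
    (hc : IsTwistedCost c Ω Λ) (hΛconv : CConvexTarget c Ω Λ) (hxm : xm ∈ Ω) (hy₀ : y₀ ∈ Λ)
    (hy₁ : y₁ ∈ Λ) (hθ : θ ∈ Icc (0 : ℝ) 1) :
    ySeg c Λ xm y₀ y₁ θ ∈ Λ ∧ ContDiffAt ℝ 3 (ySeg c Λ xm y₀ y₁) θ ∧
      ∀ᶠ θ' in 𝓝 θ, negGradX c xm (ySeg c Λ xm y₀ y₁ θ') = pSeg c xm y₀ y₁ θ' := by
  have hmem : pSeg c xm y₀ y₁ θ ∈ cExpDom c Λ xm :=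
    hΛconv xm hxm ⟨y₀, hy₀, rfl⟩ ⟨y₁, hy₁, rfl⟩ (sub_nonneg.2 hθ.2) hθ.1 (by ring)
  have hp : ContDiffAt ℝ 3 (pSeg c xm y₀ y₁) θ := by
    unfold pSeg
    fun_prop
  obtain ⟨h1, h2⟩ := hc.contDiffAt_cExp_comp (u := fun _ => xm) contDiffAt_const hp hxm hmem
  exact ⟨cExp_mem hmem, h1, h2.mono fun _ h => negGradX_cExp h⟩

lemma starSeg_spec {c : E → E → ℝ} {Ω Λ : Set E} {x₀ x₁ : E} {y : ℝ → E} {s t : ℝ}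
    (hc : IsTwistedCost c Ω Λ) (hΩconv : CStarConvexSource c Ω Λ) (hx₀ : x₀ ∈ Ω) (hx₁ : x₁ ∈ Ω)
    (hyt : y t ∈ Λ) (hy : ContDiffAt ℝ 3 y t) (hs : s ∈ Icc (0 : ℝ) 1) :
    starSeg c Ω y x₀ x₁ (s, t) ∈ Ω ∧ ContDiffAt ℝ 3 (starSeg c Ω y x₀ x₁) (s, t) ∧
      ∀ᶠ s' in 𝓝 s, negGradY c (starSeg c Ω y x₀ x₁ (s', t)) (y t) =
        negGradY c x₀ (y t) + s' • (negGradY c x₁ (y t) - negGradY c x₀ (y t)) := by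
  set p : ℝ × ℝ → E := fun z =>
    (1 - z.1) • negGradY c x₀ (y z.2) + z.1 • negGradY c x₁ (y z.2) with hpdef
  have hmem : p (s, t) ∈ cExpDom (cStar c) Ω (y t) :=
    hΩconv _ hyt ⟨x₀, hx₀, rfl⟩ ⟨x₁, hx₁, rfl⟩ (sub_nonneg.2 hs.2) hs.1 (by ring)
  have hyz : ContDiffAt ℝ 3 (fun z : ℝ × ℝ => y z.2) (s, t) :=
    ContDiffAt.comp (s, t) (g := y) (f := Prod.snd) hy contDiffAt_snd
  have hq : ∀ x' ∈ Ω, ContDiffAt ℝ 3 (fun z : ℝ × ℝ => negGradY c x' (y z.2)) (s, t) :=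
    fun x' hx' => ContDiffAt.comp (s, t) (g := fun q : E × E => negGradY c q.1 q.2)
      (f := fun z : ℝ × ℝ => (x', y z.2))
      (contDiffAt_negGradY (hc.contDiffAt _ hx' _ hyt) (by norm_num)) (contDiffAt_const.prodMk hyz)
  have hp : ContDiffAt ℝ 3 p (s, t) :=
    ((contDiffAt_const.sub contDiffAt_fst).smul (hq x₀ hx₀)).add (contDiffAt_fst.smul (hq x₁ hx₁))
  obtain ⟨h1, h2⟩ := hc.swap.contDiffAt_cExp_comp hyz hp hyt hmem
  refine ⟨cExp_mem hmem, h1, ?_⟩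
  filter_upwards [(tendsto_prodMk_left_nhds (s, t)).eventually h2] with s' hs'
  refine (negGradX_cExp hs').trans ?_
  simp only [hpdef]
  module

lemma starSeg_zero {c : E → E → ℝ} {Ω Λ : Set E} {x₀ x₁ : E} {y : ℝ → E} {t : ℝ}
    (hc : IsTwistedCost c Ω Λ) (hx₀ : x₀ ∈ Ω) (hyt : y t ∈ Λ) :
    starSeg c Ω y x₀ x₁ (0, t) = x₀ := by
  simp only [starSeg, sub_zero, one_smul, zero_smul, add_zero]
  exact hc.swap.cExp_negGradX hyt hx₀

lemma starSeg_one {c : E → E → ℝ} {Ω Λ : Set E} {x₀ x₁ : E} {y : ℝ → E} {t : ℝ}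
    (hc : IsTwistedCost c Ω Λ) (hx₁ : x₁ ∈ Ω) (hyt : y t ∈ Λ) :
    starSeg c Ω y x₀ x₁ (1, t) = x₁ := by
  simp only [starSeg, sub_self, one_smul, zero_smul, zero_add]
  exact hc.swap.cExp_negGradX hyt hx₁

lemma fderiv_starSeg_ne_zero {c : E → E → ℝ} {Ω Λ : Set E} {x₀ x₁ : E} {y : ℝ → E} {s t : ℝ}
    (hc : IsTwistedCost c Ω Λ) (hΩconv : CStarConvexSource c Ω Λ) (hx₀ : x₀ ∈ Ω) (hx₁ : x₁ ∈ Ω)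
    (hne : x₁ ≠ x₀) (hyt : y t ∈ Λ) (hy : ContDiffAt ℝ 3 y t) (hs : s ∈ Icc (0 : ℝ) 1) :
    fderiv ℝ (starSeg c Ω y x₀ x₁) (s, t) (1, 0) ≠ 0 := by
  obtain ⟨hmem, hX, hseg⟩ := hc.starSeg_spec hΩconv hx₀ hx₁ hyt hy hs
  intro h0
  have hN : DifferentiableAt ℝ (fun x' => negGradY c x' (y t)) (starSeg c Ω y x₀ x₁ (s, t)) :=
    (hasFDerivAt_comp_prodMk_left ((contDiffAt_negGradY (m := 3)
      (hc.contDiffAt _ hmem _ hyt) (by norm_num)).differentiableAt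
        (by simp)).hasFDerivAt).differentiableAt
  have h1 := HasFDerivAt.comp_hasDerivAt s (l := fun x' => negGradY c x' (y t))
    (f := fun s' => starSeg c Ω y x₀ x₁ (s', t)) hN.hasFDerivAt
    (hasDerivAt_fst_of_differentiableAt (hX.differentiableAt (by simp)))
  have h2 : HasDerivAt (fun s' : ℝ => negGradY c x₀ (y t)
      + s' • (negGradY c x₁ (y t) - negGradY c x₀ (y t)))
      (negGradY c x₁ (y t) - negGradY c x₀ (y t)) s := by
    simpa using ((hasDerivAt_id s).smul_const
      (negGradY c x₁ (y t) - negGradY c x₀ (y t))).const_add (negGradY c x₀ (y t))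
  have h3 := h1.unique (h2.congr_of_eventuallyEq hseg)
  rw [h0, map_zero, eq_comm, sub_eq_zero] at h3
  exact hne (hc.injOn_negGradY _ hyt hx₁ hx₀ h3)

end IsTwistedCost

namespace IsTwistedCost

/-- Along a curve `y` which is a `c`-segment with respect to `x₀`, the second derivative of
`τ ↦ -c(x₁, y τ) + c(x₀, y τ)` is controlled by curvature bounds on the `c*`-segment from `x₀` to
`x₁` with respect to `y t`. -/
lemma neg_le_deriv_deriv_negCost_sub {c : E → E → ℝ} {Ω Λ : Set E} {x₀ x₁ : E} {y : ℝ → E}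
    {t K : ℝ} (hc : IsTwistedCost c Ω Λ) (hΩconv : CStarConvexSource c Ω Λ) (hx₀ : x₀ ∈ Ω)
    (hx₁ : x₁ ∈ Ω) (hyt : y t ∈ Λ) (hy : ContDiffAt ℝ 3 y t)
    (hyseg : ∃ a b : E, ∀ᶠ t' in 𝓝 t, negGradX c x₀ (y t') = a + t' • b) (hK : 0 ≤ K)
    (hS : ∀ s ∈ Icc (0 : ℝ) 1, -K ≤ cSectional c Λ (starSeg c Ω y x₀ x₁ (s, t)) (y t)
      (fderiv ℝ (starSeg c Ω y x₀ x₁) (s, t) (1, 0))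
      (fderiv ℝ (fun y' => negGradX c (starSeg c Ω y x₀ x₁ (s, t)) y') (y t) (deriv y t))) :
    -K ≤ deriv (deriv fun τ => negCost c (x₁, y τ) - negCost c (x₀, y τ)) t := by
  set x : ℝ → E := fun s => starSeg c Ω y x₀ x₁ (s, t) with hx
  set H : ℝ × ℝ → ℝ := fun z => negCost c (x z.1, y z.2) with hH
  have hspec := fun s (hs : s ∈ Icc (0 : ℝ) 1) =>
    hc.starSeg_spec hΩconv hx₀ hx₁ hyt hy hs
  have hxc : ∀ s ∈ Icc (0 : ℝ) 1, ContDiffAt ℝ 3 x s := fun s hs =>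
    ContDiffAt.comp s (g := starSeg c Ω y x₀ x₁) (f := fun s => (s, t)) (hspec s hs).2.1
      (by fun_prop)
  have hx' : ∀ s ∈ Icc (0 : ℝ) 1, deriv x s = fderiv ℝ (starSeg c Ω y x₀ x₁) (s, t) (1, 0) :=
    fun s hs => (hasDerivAt_fst_of_differentiableAt
      ((hspec s hs).2.1.differentiableAt (by simp))).deriv
  have hF : ∀ s ∈ Icc (0 : ℝ) 1, ContDiffAt ℝ 4 (negCost c) (x s, y t) := fun s hs =>
    hc.contDiffAt _ (hspec s hs).1 _ hyt
  have hHc : ∀ s ∈ Icc (0 : ℝ) 1, ContDiffAt ℝ 3 H (s, t) := fun s hs =>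
    contDiffAt_comp_curves (z := (s, t)) ((hF s hs).of_le (by norm_num)) (hxc s hs) hy
  have hMc : ∀ s ∈ Icc (0 : ℝ) 1, ContDiffAt ℝ 2 (derivSnd (derivFst H)) (s, t) := fun s hs =>
    contDiffAt_derivSnd_derivFst_comp_curves (z := (s, t)) (hF s hs) (hxc s hs) hy
  set g : ℝ → ℝ := fun s => derivSnd (derivSnd H) (s, t) with hg
  have h0mem : (0 : ℝ) ∈ Icc (0 : ℝ) 1 := by simp
  have h1mem : (1 : ℝ) ∈ Icc (0 : ℝ) 1 := by simp
  have hx0 : x 0 = x₀ := hc.starSeg_zero hx₀ hyt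
  have hx1 : x 1 = x₁ := hc.starSeg_one hx₁ hyt
  have hcurve : ∀ x' ∈ Ω, ContDiffAt ℝ 3 (fun τ => negCost c (x', y τ)) t := fun x' hx' =>
    ContDiffAt.comp t (g := negCost c) (f := fun τ => (x', y τ))
      ((hc.contDiffAt _ hx' _ hyt).of_le (by norm_num)) (contDiffAt_const.prodMk hy)
  have hsub : deriv (deriv fun τ => negCost c (x₁, y τ) - negCost c (x₀, y τ)) t = g 1 - g 0 := by
    have h1 : deriv (fun τ => negCost c (x₁, y τ) - negCost c (x₀, y τ)) =ᶠ[𝓝 t]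
        fun τ => deriv (fun τ => negCost c (x₁, y τ)) τ - deriv (fun τ => negCost c (x₀, y τ)) τ := by
      filter_upwards [eventually_differentiableAt ((hcurve x₁ hx₁).of_le (by norm_num)),
        eventually_differentiableAt ((hcurve x₀ hx₀).of_le (by norm_num))] with τ h1 h0
      exact deriv_fun_sub h1 h0
    have hd : ∀ x' ∈ Ω, DifferentiableAt ℝ (deriv fun τ => negCost c (x', y τ)) t := fun x' hx' =>
      ((hcurve x' hx').derivWithin (m := 2) (by norm_num)).differentiableAt (by simp)
    rw [h1.deriv_eq, deriv_fun_sub (hd x₁ hx₁) (hd x₀ hx₀), ← hx0, ← hx1]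
    rfl
  rw [hsub]
  have hg' : ∀ s ∈ Icc (0 : ℝ) 1, deriv g =ᶠ[𝓝 s]
      fun s' => derivSnd (derivSnd (derivFst H)) (s', t) :=
    fun s hs => (tendsto_prodMk_left_nhds (s, t)).eventually (derivFst_derivSnd_derivSnd (hHc s hs))
  refine neg_le_sub_of_neg_le_deriv_deriv hK (fun s hs => ?_) (fun s hs => ?_) ?_ fun s hs => ?_
  · exact (hasDerivAt_fst_of_differentiableAt ((((hHc s hs).derivSnd (m := 2)
      (by norm_num)).derivSnd (m := 1) (by norm_num)).differentiableAt (by simp))).differentiableAt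
  · refine DifferentiableAt.congr_of_eventuallyEq ?_ (hg' s hs)
    exact (hasDerivAt_fst_of_differentiableAt (((hMc s hs).derivSnd (m := 1)
      (by norm_num)).differentiableAt (by simp))).differentiableAt
  · rw [(hg' 0 h0mem).eq_of_nhds]
    refine (deriv_deriv_eq_zero_of_affine (f := fun τ => derivFst H (0, τ)) ?_).ge
    obtain ⟨a, b, hab⟩ := hyseg
    refine ⟨⟪a, deriv x 0⟫, ⟪b, deriv x 0⟫, ?_⟩
    filter_upwards [hab, hy.continuousAt.eventually (hc.isOpen_target.mem_nhds hyt)] with τ h1 h2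
    have hd : DifferentiableAt ℝ (negCost c) (x₀, y τ) :=
      (hc.contDiffAt _ hx₀ _ h2).differentiableAt (by simp)
    rw [hH, derivFst_comp_curves (z := (0, τ)) (by rwa [hx0])
      ((hxc 0 h0mem).differentiableAt (by simp))]
    simp only [hx0]
    rw [← inner_negGradX hd, h1, inner_add_left, real_inner_smul_left]
  · have h1 := hc.derivFst_derivFst_derivSnd_derivSnd_negCost (hspec s hs).1 hyt (hxc s hs) hy
      ⟨_, _, (hspec s hs).2.2⟩
    rw [hx' s hs] at h1
    exact (hS s hs).trans_eq h1.symm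

/-- The mixed second derivative of `-c` along a `c*`-segment is constant on that segment. -/
lemma inner_fderiv_starSeg {c : E → E → ℝ} {Ω Λ : Set E} {x₀ x₁ : E} {y : ℝ → E} {s t : ℝ}
    (hc : IsTwistedCost c Ω Λ) (hΩconv : CStarConvexSource c Ω Λ) (hx₀ : x₀ ∈ Ω)
    (hx₁ : x₁ ∈ Ω) (hyt : y t ∈ Λ) (hy : ContDiffAt ℝ 3 y t) (hs : s ∈ Icc (0 : ℝ) 1) :
    ⟪fderiv ℝ (starSeg c Ω y x₀ x₁) (s, t) (1, 0),
      fderiv ℝ (fun y' => negGradX c (starSeg c Ω y x₀ x₁ (s, t)) y') (y t) (deriv y t)⟫ =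
      deriv (fun τ => negCost c (x₁, y τ) - negCost c (x₀, y τ)) t := by
  obtain ⟨hmem, hX, hseg⟩ := hc.starSeg_spec hΩconv hx₀ hx₁ hyt hy hs
  set x : ℝ → E := fun s => starSeg c Ω y x₀ x₁ (s, t) with hx
  have hxc : ContDiffAt ℝ 3 x s :=
    ContDiffAt.comp s (g := starSeg c Ω y x₀ x₁) (f := fun s => (s, t)) hX (by fun_prop)
  have hx' : deriv x s = fderiv ℝ (starSeg c Ω y x₀ x₁) (s, t) (1, 0) :=
    (hasDerivAt_fst_of_differentiableAt (hX.differentiableAt (by simp))).deriv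
  have hF : ContDiffAt ℝ 2 (negCost c) (x s, y t) :=
    (hc.contDiffAt _ hmem _ hyt).of_le (by norm_num)
  have hyd : DifferentiableAt ℝ y t := hy.differentiableAt (by simp)
  have hd : ∀ x' ∈ Ω, HasDerivAt (fun τ => negCost c (x', y τ))
      ⟪negGradY c x' (y t), deriv y t⟫ t :=
    fun x' hx' => by
      have h := (hc.contDiffAt _ hx' _ hyt).differentiableAt (by simp)
      rw [inner_negGradY h]
      exact HasFDerivAt.comp_hasDerivAt t (f := fun τ => (x', y τ)) h.hasFDerivAt
        ((hasDerivAt_const t x').prodMk hyd.hasDerivAt)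
  rw [((hd x₁ hx₁).fun_sub (hd x₀ hx₀)).deriv, real_inner_comm, inner_fderiv_negGradX hF, ← hx',
    ← derivSnd_derivFst_comp_curves (z := (s, t)) hF (hxc.of_le (by norm_num))
      (hy.of_le (by norm_num)),
    ← derivFst_derivSnd_comm_at (contDiffAt_comp_curves (z := (s, t)) hF (hxc.of_le (by norm_num))
      (hy.of_le (by norm_num))), ← inner_sub_left]
  set v := negGradY c x₁ (y t) - negGradY c x₀ (y t)
  have h1 : HasDerivAt (fun s' : ℝ => ⟪negGradY c x₀ (y t), deriv y t⟫ + s' * ⟪v, deriv y t⟫)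
      ⟪v, deriv y t⟫ s := by
    simpa using ((hasDerivAt_id s).mul_const ⟪v, deriv y t⟫).const_add
      ⟪negGradY c x₀ (y t), deriv y t⟫
  refine (h1.congr_of_eventuallyEq ?_).deriv
  filter_upwards [hseg, hxc.continuousAt.eventually (hc.isOpen_source.mem_nhds hmem)] with s' h1 h2
  have h3 : DifferentiableAt ℝ (negCost c) (x s', y t) :=
    (hc.contDiffAt _ h2 _ hyt).differentiableAt (by simp)
  refine (derivSnd_comp_curves (z := (s', t)) h3 hyd).trans ?_
  rw [← inner_negGradY h3, ← real_inner_smul_left, ← inner_add_left]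
  exact congrArg (fun w => ⟪w, deriv y t⟫) h1

/-- Under (A3W), along a curve that is a `c`-segment with respect to `x₀`, the function
`f τ = -c(x₁, y τ) + c(x₀, y τ)` satisfies `f'' ≥ -C |f'|`. -/
lemma exists_neg_mul_abs_le_deriv_deriv {c : E → E → ℝ} {Ω Λ : Set E} {x₀ x₁ : E} {y : ℝ → E}
    (hc : IsTwistedCost c Ω Λ) (h3 : A3W c Ω Λ) (hΩconv : CStarConvexSource c Ω Λ) (hx₀ : x₀ ∈ Ω)
    (hx₁ : x₁ ∈ Ω) (hne : x₁ ≠ x₀) (hyΛ : ∀ t ∈ Icc (0 : ℝ) 1, y t ∈ Λ)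
    (hy : ∀ t ∈ Icc (0 : ℝ) 1, ContDiffAt ℝ 3 y t)
    (hyseg : ∀ t ∈ Icc (0 : ℝ) 1, ∃ a b : E, ∀ᶠ t' in 𝓝 t, negGradX c x₀ (y t') = a + t' • b) :
    ∃ C, ∀ t ∈ Icc (0 : ℝ) 1,
      -(C * |deriv (fun τ => negCost c (x₁, y τ) - negCost c (x₀, y τ)) t|) ≤
        deriv (deriv fun τ => negCost c (x₁, y τ) - negCost c (x₀, y τ)) t := by
  set X := starSeg c Ω y x₀ x₁ with hX
  set K : Set (ℝ × ℝ) := Icc 0 1 ×ˢ Icc 0 1 with hKdef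
  have hspec : ∀ z ∈ K, X z ∈ Ω ∧ ContDiffAt ℝ 3 X z := fun z hz => by
    have h := hc.starSeg_spec hΩconv hx₀ hx₁ (hyΛ _ hz.2) (hy _ hz.2) hz.1
    exact ⟨h.1, h.2.1⟩
  have hN : ∀ z ∈ K, ContDiffAt ℝ 3 (fun q : E × E => negGradX c q.1 q.2) (X z, y z.2) :=
    fun z hz => contDiffAt_negGradX (hc.contDiffAt _ (hspec z hz).1 _ (hyΛ _ hz.2)) (by norm_num)
  have hXc : ∀ z ∈ K, ContinuousAt X z := fun z hz => (hspec z hz).2.continuousAt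
  have hyc : ∀ z ∈ K, ContinuousAt (fun z : ℝ × ℝ => y z.2) z := fun z hz =>
    (hy _ hz.2).continuousAt.comp continuousAt_snd
  have hy'c : ∀ z ∈ K, ContinuousAt (fun z : ℝ × ℝ => deriv y z.2) z := fun z hz =>
    ((hy _ hz.2).derivWithin (m := 2) (by norm_num)).continuousAt.comp continuousAt_snd
  have hηc : ContinuousOn (fun z => fderiv ℝ X z (1, 0)) K := fun z hz =>
    (((hspec z hz).2.fderiv_right (m := 2) (by norm_num)).continuousAt.clm_apply
      continuousAt_const).continuousWithinAt
  have hξ : ∀ z ∈ K, fderiv ℝ (fun y' => negGradX c (X z) y') (y z.2) (deriv y z.2) =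
      fderiv ℝ (fun q : E × E => negGradX c q.1 q.2) (X z, y z.2) (0, deriv y z.2) :=
    fun z hz => by
      rw [(hasFDerivAt_comp_prodMk_right ((hN z hz).differentiableAt (by simp)).hasFDerivAt).fderiv]
      simp
  have hξc : ContinuousOn
      (fun z => fderiv ℝ (fun y' => negGradX c (X z) y') (y z.2) (deriv y z.2)) K := by
    refine ContinuousOn.congr (fun z hz => ?_) hξ
    have h1 : ContinuousAt
        (fun z => fderiv ℝ (fun q : E × E => negGradX c q.1 q.2) (X z, y z.2)) z :=
      ContinuousAt.comp (g := fderiv ℝ (fun q : E × E => negGradX c q.1 q.2))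
        (f := fun z => (X z, y z.2)) ((hN z hz).fderiv_right (m := 2) (by norm_num)).continuousAt
        ((hXc z hz).prodMk (hyc z hz))
    exact (h1.clm_apply (continuousAt_const.prodMk (hy'c z hz))).continuousWithinAt
  obtain ⟨C, hC⟩ := hc.exists_cSectional_ge h3 (isCompact_Icc.prod isCompact_Icc : IsCompact K)
    (fun z hz => (hXc z hz).continuousWithinAt) (fun z hz => (hyc z hz).continuousWithinAt)
    hηc hξc (fun z hz => (hspec z hz).1) (fun z hz => hyΛ _ hz.2)
    fun z hz => hc.fderiv_starSeg_ne_zero hΩconv hx₀ hx₁ hne (hyΛ _ hz.2) (hy _ hz.2) hz.1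
  refine ⟨max C 0, fun t ht => ?_⟩
  refine hc.neg_le_deriv_deriv_negCost_sub hΩconv hx₀ hx₁ (hyΛ t ht) (hy t ht) (hyseg t ht)
    (by positivity) fun s hs => ?_
  have h1 := hC (s, t) ⟨hs, ht⟩
  rw [hc.inner_fderiv_starSeg hΩconv hx₀ hx₁ (hyΛ t ht) (hy t ht) hs] at h1
  refine le_trans ?_ h1
  gcongr
  exact le_max_left _ _

end IsTwistedCost

theorem statement4 (c : E → E → ℝ) (Ω Λ : Set E) (hΩ : IsOpen Ω) (hΛ : IsOpen Λ)
    (h0 : A0 c Ω Λ) (h1 : A1 c Ω Λ) (h2 : A2 c Ω Λ)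
    (hΛconv : CConvexTarget c Ω Λ) (hΩconv : CStarConvexSource c Ω Λ)
    (h3 : A3W c Ω Λ) :
    ∀ xm ∈ Ω, ∀ y₀ ∈ Λ, ∀ y₁ ∈ Λ, ∀ θ₁ θ₂ : ℝ,
      0 ≤ θ₁ → θ₁ ≤ θ₂ → θ₂ ≤ 1 →
      Splus c Ω Λ xm y₀ y₁ θ₁ ⊆ Splus c Ω Λ xm y₀ y₁ θ₂ := by
  intro xm hxm y₀ hy₀ y₁ hy₁ θ₁ θ₂ hθ₁ hθ hθ₂ x hx
  refine ⟨hx.1, ?_⟩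
  rcases eq_or_ne x xm with rfl | hne
  · simp [slide]
  have hc := isTwistedCost_of_conditions hΩ hΛ h0 h1 h2
  set y := ySeg c Λ xm y₀ y₁ with hy
  have hspec := fun t (ht : t ∈ Icc (0 : ℝ) 1) => hc.ySeg_spec hΛconv hxm hy₀ hy₁ ht
  have hslide : (fun θ => slide c Λ xm y₀ y₁ θ x) =
      fun τ => negCost c (x, y τ) - negCost c (xm, y τ) := by
    funext τ
    simp [slide, negCost, hy]
  have hx2 := hx.2
  rw [hslide] at hx2 ⊢
  obtain ⟨C, hC⟩ := hc.exists_neg_mul_abs_le_deriv_deriv h3 hΩconv hxm hx.1 hne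
    (fun t ht => (hspec t ht).1) (fun t ht => (hspec t ht).2.1) fun t ht =>
      ⟨negGradX c xm y₀, negGradX c xm y₁ - negGradX c xm y₀, (hspec t ht).2.2.mono fun t' h => by
        rw [h, pSeg]
        module⟩
  have hsub : Icc θ₁ θ₂ ⊆ Icc 0 1 := Icc_subset_Icc hθ₁ hθ₂
  refine nonneg_of_neg_mul_abs_le_deriv hθ (fun t ht => ?_) (fun t ht => hC t (hsub ht)) hx2
  have hd : ∀ x' ∈ Ω, ContDiffAt ℝ 3 (fun τ => negCost c (x', y τ)) t := fun x' hx' =>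
    ContDiffAt.comp t (g := negCost c) (f := fun τ => (x', y τ))
      ((hc.contDiffAt _ hx' _ (hspec t (hsub ht)).1).of_le (by norm_num))
      (contDiffAt_const.prodMk (hspec t (hsub ht)).2.1)
  exact (((hd x hx.1).sub (hd xm hxm)).derivWithin (m := 2) (by norm_num)).differentiableAt (by simp)

end
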